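/- arXiv:1808.02676 — 3 statements merged into one kernel-verified Lean document; each statement's English description precedes it below -/
import Mathlib

section
/- Let d ≥ 1 and let μ(θ) := (1/d) Σ_{i=1}^d (1 − cos θ_i) for θ ∈ ℝ^d. There exists a constant C > 0 such that for all N ∈ ℕ and all θ ∈ [−Nπ, Nπ]^d \ {0}, one has N^{−2} ( ‖θ‖²/(2dN²) + ‖θ‖⁴/(4d²N⁴) )^{−1} ≤ N^{−2} ( μ(θ/N) + μ(θ/N)² )^{−1} ≤ 2d/‖θ‖² + Cd/(2N²), where ‖·‖ is the Euclidean norm on ℝ^d. -/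
/-- The Fourier symbol of the negative discrete Laplacian on `ℤ^d`:
`μ(θ) = (1/d) ∑_{i=1}^d (1 - cos θ_i)`. -/
noncomputable def mu (d : ℕ) (θ : Fin d → ℝ) : ℝ :=
  (1 / (d : ℝ)) * ∑ i, (1 - Real.cos (θ i))

/-- The Euclidean norm on `ℝ^d`. -/
noncomputable def eucNorm {d : ℕ} (θ : Fin d → ℝ) : ℝ :=
  Real.sqrt (∑ i, θ i ^ 2)

theorem one_sub_cos_ge_sq_sub_pow_four (x : ℝ) : x ^ 2 / 2 - x ^ 4 / 2 ≤ 1 - Real.cos x := by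
  rcases le_total |x| 1 with h | h
  · have h1 := (abs_le.1 (Real.cos_bound h)).2
    have h2 : |x| ^ 4 = x ^ 4 := Even.pow_abs (by decide) x
    have h3 : 0 ≤ x ^ 4 := by positivity
    rw [h2] at h1
    linarith
  · have h1 : 1 ≤ x ^ 2 := (one_le_sq_iff_one_le_abs x).2 h
    nlinarith [Real.cos_le_one x]

theorem one_sub_cos_ge_sq_div_six {x : ℝ} (hx : |x| ≤ Real.pi) :
    x ^ 2 / 6 ≤ 1 - Real.cos x := by
  have h1 := Real.cos_le_one_sub_mul_cos_sq hx
  have h2 : (1 / 6 : ℝ) ≤ 2 / Real.pi ^ 2 := by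
    rw [div_le_div_iff₀ (by norm_num) (by positivity)]
    nlinarith [Real.pi_lt_d2, Real.pi_pos]
  nlinarith [mul_le_mul_of_nonneg_right h2 (sq_nonneg x)]

theorem sq_eucNorm {d : ℕ} (θ : Fin d → ℝ) : eucNorm θ ^ 2 = ∑ i, θ i ^ 2 :=
  Real.sq_sqrt (Finset.sum_nonneg fun i _ => sq_nonneg (θ i))

theorem mu_le (d : ℕ) (x : Fin d → ℝ) : mu d x ≤ (∑ i, x i ^ 2) / (2 * d) := by
  have h : ∑ i, (1 - Real.cos (x i)) ≤ (∑ i, x i ^ 2) / 2 := by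
    rw [Finset.sum_div]
    exact Finset.sum_le_sum fun i _ => by linarith [Real.one_sub_sq_div_two_le_cos (x := x i)]
  calc mu d x ≤ (1 / (d : ℝ)) * ((∑ i, x i ^ 2) / 2) :=
        mul_le_mul_of_nonneg_left h (by positivity)
    _ = _ := by rw [div_mul_div_comm, one_mul, mul_comm (d : ℝ)]

theorem mu_ge_of_abs_le_pi {d : ℕ} {x : Fin d → ℝ} (hx : ∀ i, |x i| ≤ Real.pi) :
    (∑ i, x i ^ 2) / (6 * d) ≤ mu d x := by
  have h : (∑ i, x i ^ 2) / 6 ≤ ∑ i, (1 - Real.cos (x i)) := by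
    rw [Finset.sum_div]
    exact Finset.sum_le_sum fun i _ => one_sub_cos_ge_sq_div_six (hx i)
  calc _ = (1 / (d : ℝ)) * ((∑ i, x i ^ 2) / 6) := by
        rw [div_mul_div_comm, one_mul, mul_comm (d : ℝ)]
    _ ≤ mu d x := mul_le_mul_of_nonneg_left h (by positivity)

theorem mu_ge_sub_sq (d : ℕ) (x : Fin d → ℝ) :
    (∑ i, x i ^ 2) / (2 * d) - (∑ i, x i ^ 2) ^ 2 / (2 * d) ≤ mu d x := by
  have h4 : ∑ i, x i ^ 4 ≤ (∑ i, x i ^ 2) ^ 2 := by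
    have := Finset.sum_sq_le_sq_sum_of_nonneg (s := Finset.univ) (f := fun i => x i ^ 2)
      fun i _ => sq_nonneg (x i)
    simpa only [← pow_mul] using this
  have h : (∑ i, x i ^ 2) / 2 - (∑ i, x i ^ 2) ^ 2 / 2 ≤ ∑ i, (1 - Real.cos (x i)) := by
    calc _ ≤ (∑ i, x i ^ 2) / 2 - (∑ i, x i ^ 4) / 2 := by linarith
      _ = ∑ i, (x i ^ 2 / 2 - x i ^ 4 / 2) := by
        rw [Finset.sum_sub_distrib, Finset.sum_div, Finset.sum_div]
      _ ≤ _ := Finset.sum_le_sum fun i _ => one_sub_cos_ge_sq_sub_pow_four (x i)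
  calc _ = (1 / (d : ℝ)) * ((∑ i, x i ^ 2) / 2 - (∑ i, x i ^ 2) ^ 2 / 2) := by
        rw [mul_sub, div_mul_div_comm, div_mul_div_comm, one_mul, one_mul, mul_comm (d : ℝ)]
    _ ≤ mu d x := mul_le_mul_of_nonneg_left h (by positivity)

theorem inv_add_sq_le {d s m : ℝ} (hd : 0 < d) (hs : 0 < s) (h₁ : s / (6 * d) ≤ m)
    (h₂ : s / (2 * d) - s ^ 2 / (2 * d) ≤ m) : (m + m ^ 2)⁻¹ ≤ 2 * d / s + 6 * d := by
  have hm : 0 < m := lt_of_lt_of_le (by positivity) h₁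
  rw [div_le_iff₀ (by positivity)] at h₁
  rw [← sub_div, div_le_iff₀ (by positivity)] at h₂
  calc (m + m ^ 2)⁻¹ ≤ m⁻¹ := inv_anti₀ hm (by nlinarith [sq_nonneg m])
    _ ≤ 2 * d / s + 6 * d := by
      rw [div_add' _ _ _ hs.ne', inv_eq_one_div, div_le_div_iff₀ hm hs]
      nlinarith [mul_le_mul_of_nonneg_right h₁ hs.le]

theorem stmt0 (d : ℕ) (hd : 1 ≤ d) :
    ∃ C : ℝ, 0 < C ∧ ∀ (N : ℕ) (θ : Fin d → ℝ),
      (∀ i, θ i ∈ Set.Icc (-(N : ℝ) * Real.pi) ((N : ℝ) * Real.pi)) → θ ≠ 0 →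
        ((N : ℝ) ^ 2)⁻¹ *
            (eucNorm θ ^ 2 / (2 * d * (N : ℝ) ^ 2) +
              eucNorm θ ^ 4 / (4 * (d : ℝ) ^ 2 * (N : ℝ) ^ 4))⁻¹
          ≤ ((N : ℝ) ^ 2)⁻¹ *
              (mu d (fun i => θ i / N) + (mu d fun i => θ i / N) ^ 2)⁻¹ ∧
        ((N : ℝ) ^ 2)⁻¹ *
            (mu d (fun i => θ i / N) + (mu d fun i => θ i / N) ^ 2)⁻¹
          ≤ 2 * d / eucNorm θ ^ 2 + C * d / (2 * (N : ℝ) ^ 2) := by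
  have hd0 : (0 : ℝ) < d := by exact_mod_cast hd
  refine ⟨12, by norm_num, fun N θ hθ hne => ?_⟩
  obtain ⟨j, hj⟩ := Function.ne_iff.1 hne
  have hN : (0 : ℝ) < N := by
    rcases Nat.eq_zero_or_pos N with rfl | h
    · have := hθ j
      simp only [Nat.cast_zero, neg_zero, zero_mul, Set.Icc_self, Set.mem_singleton_iff] at this
      exact absurd this hj
    · exact_mod_cast h
  have hE : 0 < eucNorm θ ^ 2 := by
    rw [sq_eucNorm]
    exact Finset.sum_pos' (fun i _ => sq_nonneg _) ⟨j, Finset.mem_univ j, sq_pos_of_ne_zero hj⟩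
  have hs : ∑ i, (θ i / N) ^ 2 = eucNorm θ ^ 2 / (N : ℝ) ^ 2 := by
    simp only [sq_eucNorm, div_pow, Finset.sum_div]
  have hx : ∀ i, |θ i / N| ≤ Real.pi := fun i => by
    rw [abs_div, abs_of_pos hN, div_le_iff₀ hN, abs_le]
    constructor <;> linarith [(hθ i).1, (hθ i).2]
  have h₀ := mu_le d fun i => θ i / N
  have h₁ := mu_ge_of_abs_le_pi hx
  have h₂ := mu_ge_sub_sq d fun i => θ i / N
  rw [hs] at h₀ h₁ h₂
  have hm : 0 < mu d fun i => θ i / N := lt_of_lt_of_le (by positivity) h₁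
  constructor
  · refine mul_le_mul_of_nonneg_left (inv_anti₀ (by positivity) ?_) (by positivity)
    calc _ ≤ eucNorm θ ^ 2 / (N : ℝ) ^ 2 / (2 * d)
          + (eucNorm θ ^ 2 / (N : ℝ) ^ 2 / (2 * d)) ^ 2 := by gcongr
      _ = _ := by field_simp; ring
  · calc _ ≤ ((N : ℝ) ^ 2)⁻¹ * (2 * d / (eucNorm θ ^ 2 / (N : ℝ) ^ 2) + 6 * d) :=
          mul_le_mul_of_nonneg_left (inv_add_sq_le hd0 (by positivity) h₁ h₂) (by positivity)
      _ = _ := by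
        field_simp
        ring
end

section
/- Let d ≥ 3 and define G(0,x) := (2π)^{−d} ∫_{[−π,π]^d} (μ(θ)+μ(θ)²)^{−1} e^{−i⟨x,θ⟩} dθ for x ∈ ℤ^d, k := 1/√(2d). Fix f ∈ C_c^∞(ℝ^d) and for λ ∈ (0,1] set f_λ(x) := λ^{−d} f(x/λ). Then for every s > d there exists a constant C = C(f,s,d) > 0 such that for all N ∈ ℕ and all λ ∈ (0,1], k² N^{−(d+2)} Σ_{x,y ∈ ℤ^d} f_λ(x/N) f_λ(y/N) G(0, x−y) ≤ C λ^{−2s}. -/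
open MeasureTheory

/-- The lattice Green's function of the infinite-volume `(∇+Δ)`-model with `κ₁ = κ₂ = 1`:
`G(0,x) = (2π)^{-d} ∫_{[-π,π]^d} (μ(θ)+μ(θ)²)⁻¹ e^{-i⟨x,θ⟩} dθ` (which is real-valued). -/
noncomputable def Gfun (d : ℕ) (x : Fin d → ℤ) : ℝ :=
  ((2 * Real.pi) ^ d)⁻¹ *
    (∫ θ in Set.Icc (fun _ => -Real.pi : Fin d → ℝ) (fun _ => Real.pi),
      (((mu d θ + mu d θ ^ 2 : ℝ) : ℂ))⁻¹ *
        Complex.exp (-Complex.I * ((∑ i, (x i : ℝ) * θ i : ℝ) : ℂ))).re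

/-- The rescaled test function `f_λ(x) = λ^{-d} f(x/λ)`. -/
noncomputable def fLam (d : ℕ) (f : (Fin d → ℝ) → ℝ) (lam : ℝ) (x : Fin d → ℝ) : ℝ :=
  (lam ^ d)⁻¹ * f (fun i => x i / lam)

section

open Set

theorem mul_norm_sq_le_mu {d : ℕ} {θ : Fin d → ℝ}
    (hθ : θ ∈ Icc (fun _ => -Real.pi : Fin d → ℝ) (fun _ => Real.pi)) :
    2 / (Real.pi ^ 2 * d) * ‖θ‖ ^ 2 ≤ mu d θ := by
  have hpi := Real.pi_pos
  have hnorm : ‖θ‖ ^ 2 ≤ ∑ i, θ i ^ 2 := by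
    have h : ‖θ‖ ≤ Real.sqrt (∑ i, θ i ^ 2) := by
      refine (pi_norm_le_iff_of_nonneg (Real.sqrt_nonneg _)).2 fun i => ?_
      refine Real.le_sqrt_of_sq_le ?_
      rw [Real.norm_eq_abs, sq_abs]
      exact Finset.single_le_sum (f := fun i => θ i ^ 2) (fun _ _ => sq_nonneg _)
        (Finset.mem_univ i)
    calc ‖θ‖ ^ 2 ≤ Real.sqrt (∑ i, θ i ^ 2) ^ 2 := by gcongr
      _ = _ := Real.sq_sqrt (Finset.sum_nonneg fun _ _ => sq_nonneg _)
  have hcos : 2 / Real.pi ^ 2 * ∑ i, θ i ^ 2 ≤ ∑ i, (1 - Real.cos (θ i)) := by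
    rw [Finset.mul_sum]
    refine Finset.sum_le_sum fun i _ => ?_
    linarith [Real.cos_le_one_sub_mul_cos_sq (abs_le.2 ⟨hθ.1 i, hθ.2 i⟩)]
  calc 2 / (Real.pi ^ 2 * d) * ‖θ‖ ^ 2 ≤ 2 / (Real.pi ^ 2 * d) * ∑ i, θ i ^ 2 := by gcongr
    _ = 1 / (d : ℝ) * (2 / Real.pi ^ 2 * ∑ i, θ i ^ 2) := by
      rw [← mul_assoc]; congr 1; rw [div_mul_div_comm]; ring
    _ ≤ _ := by unfold mu; gcongr

theorem mu_nonneg (d : ℕ) (θ : Fin d → ℝ) : 0 ≤ mu d θ :=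
  mul_nonneg (by positivity)
    (Finset.sum_nonneg fun i _ => sub_nonneg.2 (Real.cos_le_one (θ i)))

theorem continuous_mu (d : ℕ) : Continuous (mu d) := by
  unfold mu; fun_prop

theorem inv_mu_add_sq_le {d : ℕ} (hd : d ≠ 0) {θ : Fin d → ℝ}
    (hθ : θ ∈ Icc (fun _ => -Real.pi : Fin d → ℝ) (fun _ => Real.pi)) :
    (mu d θ + mu d θ ^ 2)⁻¹ ≤ Real.pi ^ 2 * d / 2 * (‖θ‖ ^ 2)⁻¹ := by
  have hpi := Real.pi_pos
  rcases eq_or_ne θ 0 with rfl | h0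
  · simp [mu]
  have h0 : 0 < ‖θ‖ := norm_pos_iff.2 h0
  have hd : (0 : ℝ) < d := by positivity
  rw [← inv_div 2, ← mul_inv]
  refine inv_anti₀ (by positivity) ?_
  linarith [mul_norm_sq_le_mu hθ, sq_nonneg (mu d θ)]

theorem pow_smul_inv_sq_eq {d : ℕ} (hd : 3 ≤ d) {y : ℝ} (hy : 0 < y) :
    y ^ (d - 1) • (y ^ 2)⁻¹ = y ^ (d - 3) := by
  obtain ⟨n, rfl⟩ := Nat.exists_eq_add_of_le' hd
  rw [show n + 3 - 1 = n + 2 by omega, show n + 3 - 3 = n by omega, smul_eq_mul, pow_add]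
  field_simp

theorem integrableOn_ball_inv_norm_sq {d : ℕ} (hd : 3 ≤ d) (r : ℝ) :
    IntegrableOn (fun θ : Fin d → ℝ => (‖θ‖ ^ 2)⁻¹) (Metric.ball 0 r) := by
  have : Nonempty (Fin d) := ⟨⟨0, by omega⟩⟩
  rw [integrableOn_fun_norm_addHaar volume (f := fun y : ℝ => (y ^ 2)⁻¹), Module.finrank_fin_fun]
  have h : IntegrableOn (fun y : ℝ => y ^ (d - 3)) (Ioo 0 r) :=
    (continuous_pow _).continuousOn.integrableOn_Icc.mono_set Ioo_subset_Icc_self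
  exact h.congr_fun (fun y hy => (pow_smul_inv_sq_eq hd hy.1).symm) measurableSet_Ioo

theorem setIntegral_ball_inv_norm_sq_eq {d : ℕ} (hd : 3 ≤ d) {r : ℝ} (hr : 0 < r) :
    ∫ θ in Metric.ball (0 : Fin d → ℝ) r, (‖θ‖ ^ 2)⁻¹ =
      d * volume.real (Metric.ball (0 : Fin d → ℝ) 1) * (r ^ (d - 2) / (d - 2 : ℕ)) := by
  have : Nonempty (Fin d) := ⟨⟨0, by omega⟩⟩
  have h1 : ∀ θ : Fin d → ℝ, (Metric.ball (0 : Fin d → ℝ) r).indicator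
      (fun θ => (‖θ‖ ^ 2)⁻¹) θ = (Iio r).indicator (fun y : ℝ => (y ^ 2)⁻¹) ‖θ‖ := by
    intro θ
    simp [indicator]
  rw [← integral_indicator measurableSet_ball]
  simp_rw [h1]
  rw [integral_fun_norm_addHaar, Module.finrank_fin_fun, nsmul_eq_mul, smul_eq_mul, mul_assoc]
  congr 2
  have h2 : ∀ y ∈ Ioi (0 : ℝ), y ^ (d - 1) • (Iio r).indicator (fun y : ℝ => (y ^ 2)⁻¹) y =
      (Iio r).indicator (fun y => y ^ (d - 3)) y := by
    intro y hy
    by_cases h : y < r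
    · simp only [indicator, mem_Iio, h, if_true]
      exact pow_smul_inv_sq_eq hd hy
    · simp [indicator, h]
  rw [setIntegral_congr_fun measurableSet_Ioi h2, setIntegral_indicator measurableSet_Iio,
    Ioi_inter_Iio, ← integral_Ioc_eq_integral_Ioo, ← intervalIntegral.integral_of_le hr.le,
    integral_pow]
  obtain ⟨n, rfl⟩ := Nat.exists_eq_add_of_le' hd
  simp

theorem setIntegral_Icc_exp_int_mul (n : ℤ) :
    ∫ t in Icc (-Real.pi) Real.pi, Complex.exp (-Complex.I * n * t) =
      if n = 0 then ((2 * Real.pi : ℝ) : ℂ) else 0 := by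
  have hpi := Real.pi_pos
  rw [integral_Icc_eq_integral_Ioc, ← intervalIntegral.integral_of_le (by linarith)]
  split_ifs with h
  · subst h
    simp; ring
  · have hc : -Complex.I * n ≠ 0 := by simp [h]
    rw [integral_exp_mul_complex hc, div_eq_zero_iff]
    left
    rw [sub_eq_zero, Complex.exp_eq_exp_iff_exists_int]
    exact ⟨-n, by push_cast; ring⟩

theorem continuous_cos_sum {d : ℕ} (x : Fin d → ℤ) :
    Continuous fun θ : Fin d → ℝ => Real.cos (∑ i, (x i : ℝ) * θ i) := by
  fun_prop

theorem continuous_exp_sum {d : ℕ} (x : Fin d → ℤ) :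
    Continuous fun θ : Fin d → ℝ =>
      Complex.exp (-Complex.I * ((∑ i, (x i : ℝ) * θ i : ℝ) : ℂ)) := by
  fun_prop

theorem re_exp_neg_I_mul (t : ℝ) : (Complex.exp (-Complex.I * t)).re = Real.cos t := by
  simp [Complex.exp_re]

theorem setIntegral_cos_sum_eq {d : ℕ} (x : Fin d → ℤ) :
    ∫ θ in Icc (fun _ => -Real.pi : Fin d → ℝ) (fun _ => Real.pi),
      Real.cos (∑ i, (x i : ℝ) * θ i) = if x = 0 then (2 * Real.pi) ^ d else 0 := by
  have hexp : ∫ θ in Icc (fun _ => -Real.pi : Fin d → ℝ) (fun _ => Real.pi),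
      Complex.exp (-Complex.I * ((∑ i, (x i : ℝ) * θ i : ℝ) : ℂ)) =
        ∏ i, if x i = 0 then ((2 * Real.pi : ℝ) : ℂ) else 0 := by
    simp_rw [← setIntegral_Icc_exp_int_mul]
    rw [← pi_univ_Icc, volume_pi, Measure.restrict_pi_pi,
      ← integral_fintype_prod_eq_prod (fun i (t : ℝ) => Complex.exp (-Complex.I * x i * t))]
    congr 1 with θ
    rw [← Complex.exp_sum]
    push_cast
    rw [Finset.mul_sum]
    simp_rw [mul_assoc]
  have hint : IntegrableOn (fun θ : Fin d → ℝ =>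
      Complex.exp (-Complex.I * ((∑ i, (x i : ℝ) * θ i : ℝ) : ℂ)))
      (Icc (fun _ => -Real.pi : Fin d → ℝ) (fun _ => Real.pi)) :=
    (continuous_exp_sum x).continuousOn.integrableOn_compact isCompact_Icc
  have hre := integral_re hint
  rw [hexp] at hre
  simp only [RCLike.re_to_complex, re_exp_neg_I_mul] at hre
  rw [hre]
  split_ifs with h
  · subst h
    simp only [Pi.zero_apply, if_true, Finset.prod_const, Finset.card_univ, Fintype.card_fin,
      ← Complex.ofReal_pow, Complex.ofReal_re]
  · obtain ⟨i, hi⟩ : ∃ i, x i ≠ 0 := by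
      by_contra! hc
      exact h (funext hc)
    rw [Finset.prod_eq_zero (Finset.mem_univ i) (by simp [hi])]
    rfl

theorem integrableOn_inv_mu {d : ℕ} (hd : 3 ≤ d) :
    IntegrableOn (fun θ => (mu d θ + mu d θ ^ 2)⁻¹)
      (Icc (fun _ => -Real.pi : Fin d → ℝ) (fun _ => Real.pi)) := by
  have hsub : Icc (fun _ => -Real.pi : Fin d → ℝ) (fun _ => Real.pi) ⊆ Metric.ball 0 4 := by
    intro θ hθ
    rw [mem_ball_zero_iff]
    refine lt_of_le_of_lt ((pi_norm_le_iff_of_nonneg Real.pi_pos.le).2 fun i => ?_) Real.pi_lt_four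
    exact abs_le.2 ⟨hθ.1 i, hθ.2 i⟩
  refine (((integrableOn_ball_inv_norm_sq hd 4).mono_set hsub).const_mul
    (Real.pi ^ 2 * d / 2)).mono' ?_ ?_
  · have := (continuous_mu d).measurable
    exact Measurable.aestronglyMeasurable (by fun_prop)
  · refine (ae_restrict_iff' measurableSet_Icc).2 (ae_of_all _ fun θ hθ => ?_)
    have := mu_nonneg d θ
    rw [Real.norm_of_nonneg (by positivity)]
    exact inv_mu_add_sq_le (by omega) hθ

theorem Gfun_eq_integral_cos {d : ℕ} (hd : 3 ≤ d) (x : Fin d → ℤ) :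
    Gfun d x = ((2 * Real.pi) ^ d)⁻¹ *
      ∫ θ in Icc (fun _ => -Real.pi : Fin d → ℝ) (fun _ => Real.pi),
        (mu d θ + mu d θ ^ 2)⁻¹ * Real.cos (∑ i, (x i : ℝ) * θ i) := by
  have hint : IntegrableOn (fun θ : Fin d → ℝ => (((mu d θ + mu d θ ^ 2 : ℝ) : ℂ))⁻¹ *
      Complex.exp (-Complex.I * ((∑ i, (x i : ℝ) * θ i : ℝ) : ℂ)))
      (Icc (fun _ => -Real.pi : Fin d → ℝ) (fun _ => Real.pi)) := by
    have h := (integrableOn_inv_mu hd).ofReal (𝕜 := ℂ)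
    simp only [RCLike.ofReal_inv, Complex.coe_algebraMap] at h
    refine h.mul_bdd (c := 1) (continuous_exp_sum x).aestronglyMeasurable (ae_of_all _ fun θ => ?_)
    rw [Complex.norm_exp]
    simp
  have hre := integral_re hint
  unfold Gfun
  congr 1
  rw [← RCLike.re_to_complex, ← hre]
  congr 1 with θ
  rw [← Complex.ofReal_inv, RCLike.re_to_complex, Complex.re_ofReal_mul, re_exp_neg_I_mul]

theorem sum_mul_cos_sub_nonneg {ι : Type*} (S : Finset ι) (a t : ι → ℝ) :
    0 ≤ ∑ x ∈ S, ∑ y ∈ S, a x * a y * Real.cos (t x - t y) := by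
  have h : ∑ x ∈ S, ∑ y ∈ S, a x * a y * Real.cos (t x - t y) =
      (∑ x ∈ S, a x * Real.cos (t x)) ^ 2 + (∑ x ∈ S, a x * Real.sin (t x)) ^ 2 := by
    rw [sq, sq, Finset.sum_mul_sum, Finset.sum_mul_sum, ← Finset.sum_add_distrib]
    refine Finset.sum_congr rfl fun x _ => ?_
    rw [← Finset.sum_add_distrib]
    refine Finset.sum_congr rfl fun y _ => ?_
    rw [Real.cos_sub]
    ring
  rw [h]
  positivity

theorem sum_mul_cos_le {ι : Type*} (S : Finset ι) {a : ι → ℝ} {A : ℝ} (ha : ∀ x, |a x| ≤ A)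
    (t : ι → ι → ℝ) :
    ∑ x ∈ S, ∑ y ∈ S, a x * a y * Real.cos (t x y) ≤ (S.card * A) ^ 2 := by
  have hterm : ∀ x y, a x * a y * Real.cos (t x y) ≤ A * A := fun x y => by
    refine (le_abs_self _).trans ?_
    rw [abs_mul, abs_mul]
    have hA := (abs_nonneg _).trans (ha x)
    calc |a x| * |a y| * |Real.cos (t x y)| ≤ A * A * 1 := by
          gcongr
          exacts [ha x, ha y, Real.abs_cos_le_one _]
      _ = A * A := mul_one _
  calc _ ≤ ∑ x ∈ S, ∑ y ∈ S, A * A :=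
        Finset.sum_le_sum fun x _ => Finset.sum_le_sum fun y _ => hterm x y
    _ = _ := by simp only [Finset.sum_const, nsmul_eq_mul]; ring

theorem setIntegral_sum_mul_cos_le {d : ℕ} (S : Finset (Fin d → ℤ)) {a : (Fin d → ℤ) → ℝ} {A : ℝ}
    (ha : ∀ x, |a x| ≤ A) :
    ∫ θ in Icc (fun _ => -Real.pi : Fin d → ℝ) (fun _ => Real.pi),
      ∑ x ∈ S, ∑ y ∈ S, a x * a y * Real.cos (∑ i, ((x - y) i : ℝ) * θ i) ≤
        (2 * Real.pi) ^ d * (S.card * A ^ 2) := by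
  have hpi := Real.pi_pos
  have hint : ∀ x y : Fin d → ℤ, IntegrableOn
      (fun θ : Fin d → ℝ => a x * a y * Real.cos (∑ i, ((x - y) i : ℝ) * θ i))
      (Icc (fun _ => -Real.pi : Fin d → ℝ) (fun _ => Real.pi)) := fun x y =>
    ((continuous_cos_sum (x - y)).const_mul (a x * a y)).continuousOn.integrableOn_compact
      isCompact_Icc
  rw [integral_finsetSum _ fun x _ => integrable_finsetSum _ fun y _ => hint x y]
  simp_rw [integral_finsetSum _ fun y _ => hint _ y, integral_const_mul,
    setIntegral_cos_sum_eq, sub_eq_zero]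
  simp only [mul_ite, mul_zero, Finset.sum_ite_eq]
  rw [mul_left_comm, ← nsmul_eq_mul]
  refine Finset.sum_le_card_nsmul _ _ _ fun x hx => ?_
  rw [if_pos hx, mul_comm]
  gcongr
  rw [← sq, ← sq_abs]
  gcongr
  exact ha x

/-- A quadratic form bound for the Green's function, obtained by splitting the Fourier side at
frequency `r`: the low frequencies are controlled by the `ℓ¹` norm, the high ones by Parseval. -/
theorem sum_mul_Gfun_le {d : ℕ} (hd : 3 ≤ d) :
    ∃ K : ℝ, 0 < K ∧ ∀ (S : Finset (Fin d → ℤ)) (a : (Fin d → ℤ) → ℝ) (A r : ℝ),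
      (∀ x, |a x| ≤ A) → 0 < r →
      ∑ x ∈ S, ∑ y ∈ S, a x * a y * Gfun d (x - y) ≤
        K * ((r ^ 2)⁻¹ * (S.card * A ^ 2) + r ^ (d - 2) * (S.card * A) ^ 2) := by
  have hpi := Real.pi_pos
  set Q := Icc (fun _ => -Real.pi : Fin d → ℝ) (fun _ => Real.pi) with hQ
  set K₀ := Real.pi ^ 2 * d / 2 with hK₀
  have hd0 : (0 : ℝ) < d := by positivity
  have hK₀pos : 0 < K₀ := by positivity
  set V := d * volume.real (Metric.ball (0 : Fin d → ℝ) 1) / (d - 2 : ℕ) with hV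
  have hVnn : 0 ≤ V := by positivity
  refine ⟨K₀ * (1 + ((2 * Real.pi) ^ d)⁻¹ * V), by positivity, fun S a A r ha hr => ?_⟩
  set F : (Fin d → ℝ) → ℝ := fun θ =>
    ∑ x ∈ S, ∑ y ∈ S, a x * a y * Real.cos (∑ i, ((x - y) i : ℝ) * θ i) with hF
  have hF0 : ∀ θ, 0 ≤ F θ := fun θ => by
    refine (sum_mul_cos_sub_nonneg S a fun x => ∑ i, (x i : ℝ) * θ i).trans_eq ?_
    simp only [hF, ← Finset.sum_sub_distrib, ← sub_mul, Pi.sub_apply, Int.cast_sub]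
  have hF1 : ∀ θ, F θ ≤ (S.card * A) ^ 2 := fun θ => sum_mul_cos_le S ha _
  have hFc : Continuous F := continuous_finsetSum _ fun x _ => continuous_finsetSum _ fun y _ =>
    (continuous_cos_sum (x - y)).const_mul _
  have hFint : IntegrableOn F Q := hFc.continuousOn.integrableOn_compact isCompact_Icc
  have hsum : ∑ x ∈ S, ∑ y ∈ S, a x * a y * Gfun d (x - y) =
      ((2 * Real.pi) ^ d)⁻¹ * ∫ θ in Q, (mu d θ + mu d θ ^ 2)⁻¹ * F θ := by
    have hint : ∀ x y : Fin d → ℤ, IntegrableOn (fun θ => a x * a y *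
        ((mu d θ + mu d θ ^ 2)⁻¹ * Real.cos (∑ i, ((x - y) i : ℝ) * θ i))) Q := fun x y =>
      ((integrableOn_inv_mu hd).mul_bdd (c := 1) (continuous_cos_sum (x - y)).aestronglyMeasurable
        (ae_of_all _ fun θ => Real.abs_cos_le_one _)).const_mul _
    have hpt : ∀ θ, (mu d θ + mu d θ ^ 2)⁻¹ * F θ = ∑ x ∈ S, ∑ y ∈ S, a x * a y *
        ((mu d θ + mu d θ ^ 2)⁻¹ * Real.cos (∑ i, ((x - y) i : ℝ) * θ i)) := fun θ => by
      simp only [hF, Finset.mul_sum]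
      exact Finset.sum_congr rfl fun x _ => Finset.sum_congr rfl fun y _ => by ring
    simp_rw [hpt]
    rw [integral_finsetSum _ fun x _ => integrable_finsetSum _ fun y _ => hint x y]
    simp_rw [integral_finsetSum _ fun y _ => hint _ y, integral_const_mul, Finset.mul_sum,
      Gfun_eq_integral_cos hd]
    exact Finset.sum_congr rfl fun x _ => Finset.sum_congr rfl fun y _ => by ring
  have hball := (integrable_indicator_iff measurableSet_ball).2
    (integrableOn_ball_inv_norm_sq hd r)
  set w : (Fin d → ℝ) → ℝ := (Metric.ball (0 : Fin d → ℝ) r).indicator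
    (fun θ => (‖θ‖ ^ 2)⁻¹) with hw
  have hw0 : ∀ θ, 0 ≤ w θ := fun θ => indicator_nonneg (fun _ _ => by positivity) _
  have hbound : ∫ θ in Q, (mu d θ + mu d θ ^ 2)⁻¹ * F θ ≤
      ∫ θ in Q, K₀ * ((r ^ 2)⁻¹ * F θ + (S.card * A) ^ 2 * w θ) := by
    refine integral_mono_of_nonneg (ae_of_all _ fun θ => ?_)
      (((hFint.const_mul _).add (hball.integrableOn.const_mul _)).const_mul _)
      ((ae_restrict_iff' measurableSet_Icc).2 (ae_of_all _ fun θ hθ => ?_))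
    · have := mu_nonneg d θ
      have := hF0 θ
      simp only [Pi.zero_apply]
      positivity
    · have h1 := mul_le_mul_of_nonneg_right (inv_mu_add_sq_le (by omega) hθ) (hF0 θ)
      refine h1.trans ?_
      rw [mul_assoc]
      refine mul_le_mul_of_nonneg_left ?_ hK₀pos.le
      have hr2 : 0 ≤ (r ^ 2)⁻¹ * F θ := mul_nonneg (by positivity) (hF0 θ)
      by_cases h : ‖θ‖ < r
      · have : w θ = (‖θ‖ ^ 2)⁻¹ := indicator_of_mem (mem_ball_zero_iff.2 h) _
        rw [this, mul_comm ((S.card * A) ^ 2)]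
        have := mul_le_mul_of_nonneg_left (hF1 θ) (by positivity : 0 ≤ (‖θ‖ ^ 2)⁻¹)
        linarith
      · push Not at h
        have h3 : (‖θ‖ ^ 2)⁻¹ * F θ ≤ (r ^ 2)⁻¹ * F θ :=
          mul_le_mul_of_nonneg_right (by gcongr) (hF0 θ)
        have := mul_nonneg (sq_nonneg (S.card * A)) (hw0 θ)
        linarith
  have hwint : ∫ θ in Q, w θ ≤ V * r ^ (d - 2) := by
    refine (setIntegral_le_integral hball (ae_of_all _ hw0)).trans_eq ?_
    rw [hw, integral_indicator measurableSet_ball, setIntegral_ball_inv_norm_sq_eq hd hr, hV]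
    ring
  rw [hsum]
  calc _ ≤ ((2 * Real.pi) ^ d)⁻¹ *
        ∫ θ in Q, K₀ * ((r ^ 2)⁻¹ * F θ + (S.card * A) ^ 2 * w θ) := by gcongr
    _ = ((2 * Real.pi) ^ d)⁻¹ * (K₀ * ((r ^ 2)⁻¹ * (∫ θ in Q, F θ) +
          (S.card * A) ^ 2 * ∫ θ in Q, w θ)) := by
      rw [integral_const_mul, integral_add (hFint.const_mul _) (hball.integrableOn.const_mul _),
        integral_const_mul, integral_const_mul]
    _ ≤ ((2 * Real.pi) ^ d)⁻¹ * (K₀ * ((r ^ 2)⁻¹ * ((2 * Real.pi) ^ d * (S.card * A ^ 2)) +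
          (S.card * A) ^ 2 * (V * r ^ (d - 2)))) := by
      gcongr
      exact setIntegral_sum_mul_cos_le S ha
    _ = K₀ * ((r ^ 2)⁻¹ * (S.card * A ^ 2) +
          ((2 * Real.pi) ^ d)⁻¹ * V * (r ^ (d - 2) * (S.card * A) ^ 2)) := by
      field_simp
    _ ≤ _ := by
      rw [mul_assoc K₀]
      refine mul_le_mul_of_nonneg_left ?_ hK₀pos.le
      have h1 : 0 ≤ (r ^ 2)⁻¹ * (S.card * A ^ 2) := by positivity
      have h2 : 0 ≤ r ^ (d - 2) * (S.card * A) ^ 2 := by positivity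
      have h3 : 0 ≤ ((2 * Real.pi) ^ d)⁻¹ * V := by positivity
      nlinarith [mul_nonneg h3 h1]

/-- The lattice points of a compactly supported function at scale `N * lam ≤ N` lie in a box with
at most of order `N ^ d` points. -/
theorem exists_finset_support_fLam {d : ℕ} {f : (Fin d → ℝ) → ℝ} (hsupp : HasCompactSupport f) :
    ∃ B : ℝ, 0 < B ∧ ∀ N : ℕ, 0 < N → ∃ S : Finset (Fin d → ℤ), (S.card : ℝ) ≤ (B * N) ^ d ∧
      ∀ lam ∈ Ioc (0 : ℝ) 1, ∀ x ∉ S, fLam d f lam (fun i => (x i : ℝ) / N) = 0 := by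
  obtain ⟨R, hR⟩ := hsupp.isCompact.isBounded.subset_closedBall 0
  obtain ⟨k, hk⟩ := exists_nat_ge R
  refine ⟨2 * k + 1, by positivity, fun N hN =>
    ⟨Finset.Icc (fun _ => -((k * N : ℕ) : ℤ)) (fun _ => ((k * N : ℕ) : ℤ)), ?_, ?_⟩⟩
  · have hN1 : (1 : ℝ) ≤ N := by exact_mod_cast hN
    have hcard : ((k * N : ℕ) + 1 - -((k * N : ℕ) : ℤ)).toNat = 2 * (k * N) + 1 := by omega
    rw [Pi.card_Icc]
    simp only [Int.card_Icc, hcard, Finset.prod_const, Finset.card_univ, Fintype.card_fin]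
    push_cast
    gcongr
    nlinarith
  · intro lam hlam x hx
    have hN0 : (0 : ℝ) < N := by exact_mod_cast hN
    have hlam0 := hlam.1
    unfold fLam
    by_contra hne
    refine hx ?_
    have hmem := hR (subset_tsupport f (Function.mem_support.2 (right_ne_zero_of_mul hne)))
    rw [mem_closedBall_zero_iff] at hmem
    have hb : ∀ i, |x i| ≤ ((k * N : ℕ) : ℤ) := fun i => by
      have h1 := (norm_le_pi_norm _ i).trans (hmem.trans hk)
      simp only [Real.norm_eq_abs, abs_div, abs_of_pos hN0, abs_of_pos hlam0] at h1
      rw [div_le_iff₀ hlam0, div_le_iff₀ hN0] at h1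
      have h2 : |(x i : ℝ)| ≤ k * N := by
        refine h1.trans ?_
        have : (k : ℝ) * lam ≤ k := mul_le_of_le_one_right (by positivity) hlam.2
        gcongr
      exact_mod_cast h2
    exact Finset.mem_Icc.2 ⟨fun i => (abs_le.1 (hb i)).1, fun i => (abs_le.1 (hb i)).2⟩

end

theorem stmt6 (d : ℕ) (hd : 3 ≤ d) (f : (Fin d → ℝ) → ℝ)
    (hf : ContDiff ℝ (⊤ : ℕ∞) f) (hsupp : HasCompactSupport f) (s : ℝ) (hs : (d : ℝ) < s) :
    ∃ C : ℝ, 0 < C ∧ ∀ N : ℕ, 0 < N → ∀ lam : ℝ, lam ∈ Set.Ioc (0 : ℝ) 1 →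
      (1 / (2 * (d : ℝ))) * ((N : ℝ) ^ (d + 2))⁻¹ *
          ∑' x : Fin d → ℤ, ∑' y : Fin d → ℤ,
            fLam d f lam (fun i => (x i : ℝ) / N) * fLam d f lam (fun i => (y i : ℝ) / N) *
              Gfun d (x - y)
        ≤ C * lam ^ (-(2 * s)) := by
  have hd0 : (0 : ℝ) < d := by positivity
  obtain ⟨A₀, hA₀⟩ := hsupp.exists_bound_of_continuous hf.continuous
  obtain ⟨B, hB, hS⟩ := exists_finset_support_fLam hsupp
  obtain ⟨K, hK, hG⟩ := sum_mul_Gfun_le hd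
  refine ⟨1 / (2 * d) * (K * (B ^ d * A₀ ^ 2 + (B ^ d * A₀) ^ 2)) + 1, ?_, ?_⟩
  · positivity
  intro N hN lam hlam
  have hlam0 := hlam.1
  have hN0 : (0 : ℝ) < N := by exact_mod_cast hN
  obtain ⟨S, hcard, hzero⟩ := hS N hN
  have hzero := hzero lam hlam
  set a : (Fin d → ℤ) → ℝ := fun x => fLam d f lam (fun i => (x i : ℝ) / N) with ha
  have hA : ∀ x, |a x| ≤ (lam ^ d)⁻¹ * A₀ := fun x => by
    simp only [ha, fLam]
    rw [abs_mul, abs_of_pos (by positivity)]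
    gcongr
    exact hA₀ _
  have htsum : ∑' x : Fin d → ℤ, ∑' y : Fin d → ℤ, a x * a y * Gfun d (x - y) =
      ∑ x ∈ S, ∑ y ∈ S, a x * a y * Gfun d (x - y) := by
    rw [tsum_eq_sum (s := S) fun x hx => by simp [show a x = 0 from hzero x hx]]
    refine Finset.sum_congr rfl fun x _ => ?_
    rw [tsum_eq_sum (s := S) fun y hy => by simp [show a y = 0 from hzero y hy]]
  rw [htsum]
  have hA₀nn : 0 ≤ A₀ := (norm_nonneg _).trans (hA₀ 0)
  have hmain := hG S a _ (N : ℝ)⁻¹ hA (by positivity)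
  have hlams : ((lam ^ d)⁻¹) ^ 2 ≤ lam ^ (-(2 * s)) := by
    rw [inv_pow, ← pow_mul, ← Real.rpow_natCast, ← Real.rpow_neg hlam0.le]
    refine Real.rpow_le_rpow_of_exponent_ge hlam0 hlam.2 ?_
    push_cast
    linarith
  have hbound : ∑ x ∈ S, ∑ y ∈ S, a x * a y * Gfun d (x - y) ≤
      K * (B ^ d * A₀ ^ 2 + (B ^ d * A₀) ^ 2) * (N : ℝ) ^ (d + 2) * ((lam ^ d)⁻¹) ^ 2 := by
    refine hmain.trans ?_
    calc _ ≤ K * ((((N : ℝ)⁻¹) ^ 2)⁻¹ * ((B * N) ^ d * ((lam ^ d)⁻¹ * A₀) ^ 2) +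
          ((N : ℝ)⁻¹) ^ (d - 2) * ((B * N) ^ d * ((lam ^ d)⁻¹ * A₀)) ^ 2) := by gcongr
      _ = _ := by
        obtain ⟨n, rfl⟩ := Nat.exists_eq_add_of_le' hd
        rw [show n + 3 - 2 = n + 1 by omega, inv_pow _ (n + 1)]
        field_simp
        ring
  calc _ ≤ 1 / (2 * (d : ℝ)) * ((N : ℝ) ^ (d + 2))⁻¹ *
        (K * (B ^ d * A₀ ^ 2 + (B ^ d * A₀) ^ 2) * (N : ℝ) ^ (d + 2) * ((lam ^ d)⁻¹) ^ 2) := by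
        gcongr
    _ = 1 / (2 * d) * (K * (B ^ d * A₀ ^ 2 + (B ^ d * A₀) ^ 2)) * ((lam ^ d)⁻¹) ^ 2 := by
        field_simp
    _ ≤ (1 / (2 * d) * (K * (B ^ d * A₀ ^ 2 + (B ^ d * A₀) ^ 2)) + 1) * lam ^ (-(2 * s)) := by
        gcongr
        linarith
end

section
/- Let D ⊂ ℝ^d be a bounded domain with C² boundary, K ∈ ℕ, κ₁ = 1, κ_i ≥ 0 for i = 2,…,K−1 and κ_K > 0. Let u ∈ C³(cl D) satisfy −Δ_c u = f in D and u = 0 on ∂D, and for h > 0 let u_h be a grid function on D_h satisfying L_h u_h(ξ) = f(ξ) for ξ ∈ R_h and u_h(ξ) = 0 for ξ ∈ B_h, where L_h = Σ_{i=1}^K κ_i (h²/(2d))^{i−1} (−Δ_h)^i. Set e_h := u − u_h on D_h. Then there exists a constant C > 0, independent of u, f and h, such that for all sufficiently small h, ‖R_h e_h‖_h² ≤ C [ M₃² h² + h (M₃² h⁴ + M₁²) ], where M_k := Σ_{|α| ≤ k} sup_{x∈D} |D^α u(x)|. -/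
open MeasureTheory

/-- The grid Laplacian `Δ_h g(x) = h^{-2} ∑_i (g(x+he_i)+g(x-he_i)-2g(x))`,
for grid functions indexed by `ℤ^d` (the index `z` representing the point `h·z`). -/
noncomputable def gridLap (d : ℕ) (h : ℝ) (g : (Fin d → ℤ) → ℝ) : (Fin d → ℤ) → ℝ :=
  fun z => (h ^ 2)⁻¹ * ∑ i : Fin d, (g (z + Pi.single i 1) + g (z - Pi.single i 1) - 2 * g z)

/-- The finite-difference operator `L_h = ∑_{i=1}^K κ_i (h²/(2d))^{i-1} (-Δ_h)^i`. -/
noncomputable def Lh (d K : ℕ) (κ : ℕ → ℝ) (h : ℝ) (g : (Fin d → ℤ) → ℝ) :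
    (Fin d → ℤ) → ℝ :=
  fun z => ∑ i ∈ Finset.Icc 1 K,
    κ i * (h ^ 2 / (2 * (d : ℝ))) ^ (i - 1) * ((fun v => -gridLap d h v)^[i] g) z

/-- The set of grid points in `cl D`: `D_h = cl D ∩ hℤ^d` (indexed by `ℤ^d`). -/
def Dh (d : ℕ) (D : Set (Fin d → ℝ)) (h : ℝ) : Set (Fin d → ℤ) :=
  {z | (fun i => h * (z i : ℝ)) ∈ closure D}

/-- `R_h` is the largest subset of `D_h` with `R_h ∪ ∂_{K,h}R_h ⊂ D_h`; explicitly, the set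
of points of `D_h` all of whose grid neighbours within graph distance `K` lie in `D_h`. -/
def Rh (d : ℕ) (D : Set (Fin d → ℝ)) (K : ℕ) (h : ℝ) : Set (Fin d → ℤ) :=
  {z ∈ Dh d D h | ∀ w : Fin d → ℤ, (∑ i, |w i - z i|) ≤ (K : ℤ) → w ∈ Dh d D h}

/-- `B_h = D_h \ R_h`. -/
def Bh (d : ℕ) (D : Set (Fin d → ℝ)) (K : ℕ) (h : ℝ) : Set (Fin d → ℤ) :=
  Dh d D h \ Rh d D K h

/-- The continuum Laplacian `Δ_c u(x) = ∑_i ∂²u/∂x_i²(x)`. -/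
noncomputable def contLap (d : ℕ) (u : (Fin d → ℝ) → ℝ) (x : Fin d → ℝ) : ℝ :=
  ∑ i : Fin d, iteratedFDeriv ℝ 2 u x (fun _ => Pi.single i 1)

/-- `M_k = ∑_{|α| ≤ k} sup_{x ∈ D} |D^α u(x)|`, formalized via iterated derivatives. -/
noncomputable def Mk (d : ℕ) (D : Set (Fin d → ℝ)) (u : (Fin d → ℝ) → ℝ) (k : ℕ) : ℝ :=
  ∑ j ∈ Finset.range (k + 1), ⨆ x ∈ D, ‖iteratedFDeriv ℝ j u x‖

/-- The negative lattice Laplacian of mesh size one, as a linear operator on grid functions. -/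
def negLap (d : ℕ) : ((Fin d → ℤ) → ℝ) →ₗ[ℝ] ((Fin d → ℤ) → ℝ) where
  toFun f z := ∑ i : Fin d, (2 * f z - f (z + Pi.single i 1) - f (z - Pi.single i 1))
  map_add' f g := by
    ext z
    simp only [Pi.add_apply, ← Finset.sum_add_distrib]
    exact Finset.sum_congr rfl fun i _ => by ring
  map_smul' c f := by
    ext z
    simp only [Pi.smul_apply, smul_eq_mul, RingHom.id_apply, Finset.mul_sum]
    exact Finset.sum_congr rfl fun i _ => by ring

/-- The summation pairing of two grid functions, one of which has finite support. -/
noncomputable def gridPair {d : ℕ} (f g : (Fin d → ℤ) → ℝ) : ℝ := ∑ᶠ z, f z * g z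

section ErrorEstimate

open Function

lemma gridPair_hasFiniteSupport {d : ℕ} (f : (Fin d → ℤ) → ℝ) {g : (Fin d → ℤ) → ℝ}
    (hg : HasFiniteSupport g) : HasFiniteSupport fun z => f z * g z := by
  fun_prop

lemma gridPair_comm {d : ℕ} (f g : (Fin d → ℤ) → ℝ) : gridPair f g = gridPair g f :=
  finsum_congr fun _ => mul_comm _ _

lemma gridPair_add_left {d : ℕ} (f₁ f₂ : (Fin d → ℤ) → ℝ) {g : (Fin d → ℤ) → ℝ}
    (hg : HasFiniteSupport g) : gridPair (f₁ + f₂) g = gridPair f₁ g + gridPair f₂ g := by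
  simp only [gridPair, Pi.add_apply, add_mul]
  exact finsum_add_distrib (gridPair_hasFiniteSupport f₁ hg) (gridPair_hasFiniteSupport f₂ hg)

lemma gridPair_smul_left {d : ℕ} (c : ℝ) (f g : (Fin d → ℤ) → ℝ) :
    gridPair (c • f) g = c * gridPair f g := by
  simp only [gridPair, Pi.smul_apply, smul_eq_mul, mul_assoc]
  exact (mul_finsum _ _).symm

lemma gridPair_sum_left {d : ℕ} {ι : Type*} (s : Finset ι) (f : ι → (Fin d → ℤ) → ℝ)
    {g : (Fin d → ℤ) → ℝ} (hg : HasFiniteSupport g) :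
    gridPair (∑ i ∈ s, f i) g = ∑ i ∈ s, gridPair (f i) g := by
  classical
  induction s using Finset.induction_on with
  | empty => simp [gridPair]
  | insert a s ha ih => rw [Finset.sum_insert ha, Finset.sum_insert ha, gridPair_add_left _ _ hg, ih]

lemma gridPair_self_nonneg {d : ℕ} (f : (Fin d → ℤ) → ℝ) : 0 ≤ gridPair f f :=
  finsum_nonneg fun _ => mul_self_nonneg _

/-- Translation of grid functions. -/
def gridShift {d : ℕ} (a : Fin d → ℤ) (f : (Fin d → ℤ) → ℝ) : (Fin d → ℤ) → ℝ :=
  fun z => f (z + a)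

lemma gridPair_shift {d : ℕ} (a : Fin d → ℤ) (f g : (Fin d → ℤ) → ℝ) :
    gridPair (gridShift a f) (gridShift a g) = gridPair f g :=
  finsum_comp_equiv (Equiv.addRight a) (f := fun z => f z * g z)

lemma gridPair_shift_left {d : ℕ} (a : Fin d → ℤ) (f g : (Fin d → ℤ) → ℝ) :
    gridPair (gridShift a f) g = gridPair f (gridShift (-a) g) := by
  rw [← gridPair_shift a f]
  congr 1
  ext z
  simp [gridShift]

lemma gridShift_hasFiniteSupport {d : ℕ} (a : Fin d → ℤ) {f : (Fin d → ℤ) → ℝ}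
    (hf : HasFiniteSupport f) : HasFiniteSupport (gridShift a f) :=
  HasFiniteSupport.comp_of_injective (f := f) (add_left_injective a) hf

lemma negLap_eq_sum {d : ℕ} (f : (Fin d → ℤ) → ℝ) :
    negLap d f = ∑ i : Fin d, ((2 : ℝ) • f + (-1 : ℝ) • gridShift (Pi.single i 1) f
      + (-1 : ℝ) • gridShift (-Pi.single i 1) f) := by
  ext z
  simp only [negLap, LinearMap.coe_mk, AddHom.coe_mk, Finset.sum_apply, Pi.add_apply,
    Pi.smul_apply, smul_eq_mul, gridShift, ← sub_eq_add_neg]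
  exact Finset.sum_congr rfl fun i _ => by ring

lemma negLap_hasFiniteSupport {d : ℕ} {f : (Fin d → ℤ) → ℝ}
    (hf : HasFiniteSupport f) : HasFiniteSupport (negLap d f) := by
  rw [negLap_eq_sum]
  have h1 := fun a : Fin d → ℤ => gridShift_hasFiniteSupport a hf
  have h0 (i : Fin d) : HasFiniteSupport ((2 : ℝ) • f + (-1 : ℝ) • gridShift (Pi.single i 1) f
      + (-1 : ℝ) • gridShift (-Pi.single i 1) f) :=
    (((Function.HasFiniteSupport.smul_right (fun _ => (2 : ℝ)) hf).add
      (Function.HasFiniteSupport.smul_right (fun _ => (-1 : ℝ)) (h1 _))).add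
      (Function.HasFiniteSupport.smul_right (fun _ => (-1 : ℝ)) (h1 _)))
  refine (Set.finite_iUnion h0).subset fun z hz => ?_
  rw [mem_support, Finset.sum_apply] at hz
  obtain ⟨i, -, hi⟩ := Finset.exists_ne_zero_of_sum_ne_zero hz
  exact Set.mem_iUnion.2 ⟨i, hi⟩

lemma gridPair_negLap_left {d : ℕ} {f g : (Fin d → ℤ) → ℝ}
    (hf : HasFiniteSupport f) (hg : HasFiniteSupport g) :
    gridPair (negLap d f) g = gridPair f (negLap d g) := by
  rw [gridPair_comm f, negLap_eq_sum, negLap_eq_sum, gridPair_sum_left _ _ hg,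
    gridPair_sum_left _ _ hf]
  refine Finset.sum_congr rfl fun i _ => ?_
  simp only [gridPair_add_left _ _ hg, gridPair_add_left _ _ hf, gridPair_smul_left,
    gridPair_shift_left _ f g, neg_neg]
  rw [gridPair_comm g f, gridPair_comm f (gridShift (Pi.single i 1) g),
    gridPair_comm f (gridShift (-Pi.single i 1) g)]
  ring

/-- Forward difference of a grid function in the `i`-th coordinate direction. -/
def gridDiff {d : ℕ} (i : Fin d) (f : (Fin d → ℤ) → ℝ) : (Fin d → ℤ) → ℝ :=
  gridShift (Pi.single i 1) f - f

lemma gridDiff_hasFiniteSupport {d : ℕ} (i : Fin d) {f : (Fin d → ℤ) → ℝ}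
    (hf : HasFiniteSupport f) : HasFiniteSupport (gridDiff i f) :=
  (gridShift_hasFiniteSupport _ hf).sub hf

lemma gridPair_negLap_self {d : ℕ} {f : (Fin d → ℤ) → ℝ} (hf : HasFiniteSupport f) :
    gridPair (negLap d f) f = ∑ i, gridPair (gridDiff i f) (gridDiff i f) := by
  rw [negLap_eq_sum, gridPair_sum_left _ _ hf]
  refine Finset.sum_congr rfl fun i _ => ?_
  have hs := gridShift_hasFiniteSupport (Pi.single i 1) hf
  have hd := gridDiff_hasFiniteSupport i hf
  have e : gridDiff i f = gridShift (Pi.single i 1) f + (-1 : ℝ) • f := by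
    ext z; simp [gridDiff, sub_eq_add_neg]
  rw [gridPair_add_left _ _ hf, gridPair_add_left _ _ hf]
  simp only [gridPair_smul_left]
  rw [e, gridPair_add_left _ _ (e ▸ hd), gridPair_smul_left, gridPair_comm _ (_ + _),
    gridPair_comm _ (_ + _), gridPair_add_left _ _ hs, gridPair_add_left _ _ hf, gridPair_shift]
  simp only [gridPair_smul_left, gridPair_shift_left _ f f, neg_neg]
  rw [gridPair_comm f (gridShift _ _), gridPair_shift_left _ f f, gridPair_comm f (gridShift _ _),
    gridPair_shift_left _ f f, neg_neg, gridPair_comm f (gridShift _ _), gridPair_shift_left _ f f]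
  ring

lemma hasFiniteSupport_sq {α : Type*} {f : α → ℝ} (hf : HasFiniteSupport f) :
    HasFiniteSupport fun z => f z ^ 2 := by
  simp only [sq]
  fun_prop

lemma finsum_sq_shift {d : ℕ} (a : Fin d → ℤ) (f : (Fin d → ℤ) → ℝ) :
    ∑ᶠ z, f (z + a) ^ 2 = ∑ᶠ z, f z ^ 2 :=
  finsum_comp_equiv (Equiv.addRight a) (f := fun z => f z ^ 2)

lemma gridPair_self {d : ℕ} (f : (Fin d → ℤ) → ℝ) : gridPair f f = ∑ᶠ z, f z ^ 2 :=
  finsum_congr fun _ => (sq _).symm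

lemma gridPair_gridDiff_le {d : ℕ} (i : Fin d) {f : (Fin d → ℤ) → ℝ} (hf : HasFiniteSupport f) :
    gridPair (gridDiff i f) (gridDiff i f) ≤ 4 * gridPair f f := by
  have hd := gridDiff_hasFiniteSupport i hf
  have hs := gridShift_hasFiniteSupport (Pi.single i 1) hf
  have h2 : HasFiniteSupport fun z => f z ^ 2 := hasFiniteSupport_sq hf
  have h3 : HasFiniteSupport fun z => f (z + Pi.single i 1) ^ 2 := hasFiniteSupport_sq hs
  have : gridPair (gridDiff i f) (gridDiff i f)
      ≤ ∑ᶠ z, 2 * (f (z + Pi.single i 1) ^ 2 + f z ^ 2) := by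
    refine finsum_le_finsum' (gridPair_hasFiniteSupport _ hd) (by fun_prop) fun z => ?_
    simp only [gridDiff, gridShift, Pi.sub_apply]
    nlinarith [sq_nonneg (f (z + Pi.single i 1) + f z)]
  rw [← mul_finsum, finsum_add_distrib h3 h2, finsum_sq_shift, ← gridPair_self] at this
  linarith

lemma gridPair_negLap_le {d : ℕ} {f : (Fin d → ℤ) → ℝ} (hf : HasFiniteSupport f) :
    gridPair (negLap d f) f ≤ 4 * d * gridPair f f := by
  rw [gridPair_negLap_self hf]
  refine (Finset.sum_le_sum fun i _ => gridPair_gridDiff_le i hf).trans ?_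
  simp only [Finset.sum_const, Finset.card_univ, Fintype.card_fin, nsmul_eq_mul]
  exact le_of_eq (by ring)

lemma gridPair_negLap_negLap_le {d : ℕ} {f : (Fin d → ℤ) → ℝ} (hf : HasFiniteSupport f) :
    gridPair (negLap d f) (negLap d f) ≤ (4 * d) ^ 2 * gridPair f f := by
  have h2 : HasFiniteSupport fun z => f z ^ 2 := hasFiniteSupport_sq hf
  have h3 (a : Fin d → ℤ) : HasFiniteSupport fun z => f (z + a) ^ 2 :=
    hasFiniteSupport_sq (gridShift_hasFiniteSupport a hf)
  have h4 (i : Fin d) : HasFiniteSupport fun z => 4 * (2 * f z ^ 2 + (f (z + Pi.single i 1) ^ 2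
      + f (z + -Pi.single i 1) ^ 2)) := by
    have := h3 (Pi.single i 1)
    have := h3 (-Pi.single i 1)
    fun_prop
  have : gridPair (negLap d f) (negLap d f) ≤ ∑ᶠ z, (d : ℝ) * ∑ i : Fin d,
      4 * (2 * f z ^ 2 + (f (z + Pi.single i 1) ^ 2 + f (z + -Pi.single i 1) ^ 2)) := by
    refine finsum_le_finsum' (gridPair_hasFiniteSupport _ (negLap_hasFiniteSupport hf)) ?_
      fun z => ?_
    · refine Function.HasFiniteSupport.mul_right _ ?_
      refine (Set.finite_iUnion h4).subset fun z hz => ?_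
      obtain ⟨i, -, hi⟩ := Finset.exists_ne_zero_of_sum_ne_zero hz
      exact Set.mem_iUnion.2 ⟨i, hi⟩
    · simp only [← sq, negLap, LinearMap.coe_mk, AddHom.coe_mk]
      refine (sq_sum_le_card_mul_sum_sq (α := ℝ)).trans ?_
      simp only [Finset.card_univ, Fintype.card_fin, ← sub_eq_add_neg]
      gcongr with i
      nlinarith [sq_nonneg (f (z + Pi.single i 1) - f (z - Pi.single i 1)),
        sq_nonneg (f (z + Pi.single i 1) + f z), sq_nonneg (f (z - Pi.single i 1) + f z),
        sq_nonneg (2 * f z + f (z + Pi.single i 1) + f (z - Pi.single i 1))]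
  refine this.trans (le_of_eq ?_)
  rw [← mul_finsum, finsum_sum_comm _ _ fun i _ => h4 i]
  have h5 (i : Fin d) : HasFiniteSupport fun z => f (z + Pi.single i 1) ^ 2
      + f (z + -Pi.single i 1) ^ 2 :=
    (h3 (Pi.single i 1)).add (h3 (-Pi.single i 1))
  have h6 : HasFiniteSupport fun z => 2 * f z ^ 2 := by fun_prop
  have key (i : Fin d) : ∑ᶠ z, 4 * (2 * f z ^ 2 + (f (z + Pi.single i 1) ^ 2
      + f (z + -Pi.single i 1) ^ 2)) = 16 * gridPair f f := by
    rw [← mul_finsum, finsum_add_distrib h6 (h5 i), ← mul_finsum,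
      finsum_add_distrib (h3 _) (h3 _), finsum_sq_shift, finsum_sq_shift, ← gridPair_self]
    ring
  simp only [key, Finset.sum_const, Finset.card_univ, Fintype.card_fin, nsmul_eq_mul]
  ring

lemma gridPair_negLap_pow_add_two {d : ℕ} (n : ℕ) {f : (Fin d → ℤ) → ℝ}
    (hf : HasFiniteSupport f) :
    gridPair ((negLap d ^ (n + 2)) f) f
      = gridPair ((negLap d ^ n) (negLap d f)) (negLap d f) := by
  have h (n : ℕ) : HasFiniteSupport ((negLap d ^ n) f) := by
    induction n with
    | zero => simpa using hf
    | succ n ih => rw [pow_succ']; exact negLap_hasFiniteSupport ih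
  rw [← gridPair_negLap_left (f := (negLap d ^ n) (negLap d f)) (h (n + 1)) hf]
  congr 1
  rw [show n + 2 = 1 + n + 1 by ring, pow_add, pow_add, pow_one]
  rfl

lemma gridPair_negLap_pow_nonneg {d : ℕ} (n : ℕ) {f : (Fin d → ℤ) → ℝ}
    (hf : HasFiniteSupport f) : 0 ≤ gridPair ((negLap d ^ n) f) f := by
  induction n using Nat.twoStepInduction generalizing f with
  | zero => exact gridPair_self_nonneg f
  | one =>
    rw [pow_one, gridPair_negLap_self hf]
    exact Finset.sum_nonneg fun i _ => gridPair_self_nonneg _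
  | more n ih _ =>
    rw [gridPair_negLap_pow_add_two n hf]
    exact ih (negLap_hasFiniteSupport hf)

lemma gridPair_negLap_pow_le {d : ℕ} (n : ℕ) {f : (Fin d → ℤ) → ℝ}
    (hf : HasFiniteSupport f) : gridPair ((negLap d ^ n) f) f ≤ (4 * d) ^ n * gridPair f f := by
  induction n using Nat.twoStepInduction generalizing f with
  | zero => simp
  | one => simpa using gridPair_negLap_le hf
  | more n ih _ =>
    rw [gridPair_negLap_pow_add_two n hf]
    refine (ih (negLap_hasFiniteSupport hf)).trans ?_
    rw [pow_add, mul_assoc]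
    gcongr
    exact gridPair_negLap_negLap_le hf

/-- A discrete Poincaré inequality for functions supported in a strip. -/
lemma gridPair_self_le_gridDiff {d : ℕ} (i : Fin d) {f : (Fin d → ℤ) → ℝ}
    (hf : HasFiniteSupport f) {N : ℝ} (hN : ∀ z, f z ≠ 0 → |(z i : ℝ)| ≤ N) :
    gridPair f f ≤ 4 * (N + 1) ^ 2 * gridPair (gridDiff i f) (gridDiff i f) := by
  have hd := gridDiff_hasFiniteSupport i hf
  have h2 : HasFiniteSupport fun z => f z ^ 2 := hasFiniteSupport_sq hf
  have h3 : HasFiniteSupport fun z => f (z + Pi.single i 1) ^ 2 :=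
    hasFiniteSupport_sq (gridShift_hasFiniteSupport (Pi.single i 1) hf)
  have h4 : HasFiniteSupport fun z => gridDiff i f z ^ 2 := hasFiniteSupport_sq hd
  have shift : ∑ᶠ z : Fin d → ℤ, ((z i : ℝ) + 1) * f (z + Pi.single i 1) ^ 2
      = ∑ᶠ z : Fin d → ℤ, (z i : ℝ) * f z ^ 2 := by
    rw [← finsum_comp_equiv (Equiv.addRight (Pi.single i (1 : ℤ) : Fin d → ℤ))
      (f := fun z => (z i : ℝ) * f z ^ 2)]
    simp
  have e : gridPair f f = ∑ᶠ z : Fin d → ℤ, ((z i : ℝ) + 1) * (f z ^ 2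
      - f (z + Pi.single i 1) ^ 2) := by
    simp only [mul_sub]
    rw [finsum_sub_distrib (by fun_prop) (by fun_prop), shift,
      ← finsum_sub_distrib (by fun_prop) (by fun_prop), gridPair_self]
    exact finsum_congr fun z => by ring
  have le : gridPair f f ≤ ∑ᶠ z : Fin d → ℤ, (2 * (N + 1) ^ 2 * gridDiff i f z ^ 2
      + (1 / 4) * (f z ^ 2 + f (z + Pi.single i 1) ^ 2)) := by
    rw [e]
    refine finsum_le_finsum' (by fun_prop) (by fun_prop) fun z => ?_
    simp only [gridDiff, gridShift, Pi.sub_apply]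
    set a := f z
    set b := f (z + Pi.single i 1)
    by_cases hz : a = 0 ∧ b = 0
    · simp [hz.1, hz.2]
    · have hb : |(z i : ℝ) + 1| ≤ N + 1 := by
        by_cases ha : a = 0
        · have := hN _ fun hb => hz ⟨ha, hb⟩
          simp only [Pi.add_apply, Pi.single_eq_same, Int.cast_add, Int.cast_one] at this
          linarith
        · have := hN _ ha
          exact (abs_add_le _ _).trans (by simpa using this)
      have hsq : ((z i : ℝ) + 1) ^ 2 ≤ (N + 1) ^ 2 := sq_le_sq' (abs_le.1 hb).1 (abs_le.1 hb).2
      set t := (z i : ℝ) + 1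
      nlinarith [sq_nonneg (4 * t * (b - a) + (a + b)), sq_nonneg (a - b),
        mul_le_mul_of_nonneg_right hsq (sq_nonneg (b - a))]
  rw [finsum_add_distrib (by fun_prop) (by fun_prop), ← mul_finsum, ← mul_finsum,
    finsum_add_distrib h2 h3, finsum_sq_shift, ← gridPair_self, ← gridPair_self] at le
  linarith

/-- The operator `h² L_h` written in terms of the mesh-one Laplacian; it does not depend on `h`. -/
noncomputable def scaledLh (d K : ℕ) (κ : ℕ → ℝ) :
    ((Fin d → ℤ) → ℝ) →ₗ[ℝ] ((Fin d → ℤ) → ℝ) :=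
  ∑ i ∈ Finset.Icc 1 K, (κ i * (1 / (2 * (d : ℝ))) ^ (i - 1)) • negLap d ^ i

/-- A bound for the norm of `scaledLh`. -/
noncomputable def scaledLhBound (d K : ℕ) (κ : ℕ → ℝ) : ℝ :=
  ∑ i ∈ Finset.Icc 1 K, (κ i * (1 / (2 * (d : ℝ))) ^ (i - 1)) * (4 * d) ^ i

lemma scaledLh_apply {d K : ℕ} (κ : ℕ → ℝ) (f : (Fin d → ℤ) → ℝ) :
    scaledLh d K κ f
      = ∑ i ∈ Finset.Icc 1 K, (κ i * (1 / (2 * (d : ℝ))) ^ (i - 1)) • (negLap d ^ i) f := by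
  simp [scaledLh, LinearMap.sum_apply]

lemma neg_gridLap_eq (d : ℕ) (h : ℝ) :
    (fun v => -gridLap d h v) = ⇑((h ^ 2)⁻¹ • negLap d) := by
  ext v z
  simp only [gridLap, negLap, LinearMap.smul_apply, LinearMap.coe_mk, AddHom.coe_mk,
    Pi.smul_apply, Pi.neg_apply, smul_eq_mul, ← mul_neg, ← Finset.sum_neg_distrib]
  congr 1
  exact Finset.sum_congr rfl fun i _ => by ring

lemma sq_mul_Lh {d K : ℕ} (κ : ℕ → ℝ) {h : ℝ} (hh : h ≠ 0) (g : (Fin d → ℤ) → ℝ)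
    (z : Fin d → ℤ) : h ^ 2 * Lh d K κ h g z = scaledLh d K κ g z := by
  rw [scaledLh_apply, Finset.sum_apply, Lh, Finset.mul_sum]
  refine Finset.sum_congr rfl fun i hi => ?_
  obtain ⟨j, rfl⟩ : ∃ j, i = j + 1 := ⟨i - 1, by have := (Finset.mem_Icc.1 hi).1; omega⟩
  rw [neg_gridLap_eq, ← Module.End.pow_apply, smul_pow]
  simp only [add_tsub_cancel_right, LinearMap.smul_apply, Pi.smul_apply, smul_eq_mul, div_pow,
    one_pow, pow_succ (h ^ 2)⁻¹, inv_pow]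
  field_simp

lemma gridPair_scaledLh {d K : ℕ} (κ : ℕ → ℝ) (f : (Fin d → ℤ) → ℝ) {g : (Fin d → ℤ) → ℝ}
    (hg : HasFiniteSupport g) :
    gridPair (scaledLh d K κ f) g = ∑ i ∈ Finset.Icc 1 K,
      (κ i * (1 / (2 * (d : ℝ))) ^ (i - 1)) * gridPair ((negLap d ^ i) f) g := by
  rw [scaledLh_apply, gridPair_sum_left _ _ hg]
  simp only [gridPair_smul_left]

lemma gridPair_scaledLh_nonneg {d K : ℕ} {κ : ℕ → ℝ} (hκ : ∀ i ∈ Finset.Icc 1 K, 0 ≤ κ i)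
    {f : (Fin d → ℤ) → ℝ} (hf : HasFiniteSupport f) : 0 ≤ gridPair (scaledLh d K κ f) f := by
  rw [gridPair_scaledLh κ f hf]
  refine Finset.sum_nonneg fun i hi => ?_
  have := hκ i hi
  have := gridPair_negLap_pow_nonneg i hf
  positivity

lemma gridPair_scaledLh_le {d K : ℕ} {κ : ℕ → ℝ} (hκ : ∀ i ∈ Finset.Icc 1 K, 0 ≤ κ i)
    {f : (Fin d → ℤ) → ℝ} (hf : HasFiniteSupport f) :
    gridPair (scaledLh d K κ f) f ≤ scaledLhBound d K κ * gridPair f f := by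
  rw [gridPair_scaledLh κ f hf, scaledLhBound, Finset.sum_mul]
  refine Finset.sum_le_sum fun i hi => ?_
  have := hκ i hi
  rw [mul_assoc _ _ (gridPair f f)]
  exact mul_le_mul_of_nonneg_left (gridPair_negLap_pow_le i hf) (by positivity)

lemma gridPair_negLap_le_scaledLh {d K : ℕ} {κ : ℕ → ℝ} (hK : 1 ≤ K) (hκ1 : κ 1 = 1)
    (hκ : ∀ i ∈ Finset.Icc 1 K, 0 ≤ κ i) {f : (Fin d → ℤ) → ℝ} (hf : HasFiniteSupport f) :
    gridPair (negLap d f) f ≤ gridPair (scaledLh d K κ f) f := by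
  rw [gridPair_scaledLh κ f hf]
  have h1 : gridPair (negLap d f) f
      = (κ 1 * (1 / (2 * (d : ℝ))) ^ (1 - 1)) * gridPair ((negLap d ^ 1) f) f := by
    simp [hκ1]
  rw [h1]
  refine Finset.single_le_sum (f := fun i => (κ i * (1 / (2 * (d : ℝ))) ^ (i - 1))
    * gridPair ((negLap d ^ i) f) f) (fun i hi => ?_) (Finset.mem_Icc.2 ⟨le_rfl, hK⟩)
  have := hκ i hi
  have := gridPair_negLap_pow_nonneg i hf
  positivity

lemma negLap_pow_hasFiniteSupport {d : ℕ} (n : ℕ) {f : (Fin d → ℤ) → ℝ}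
    (hf : HasFiniteSupport f) : HasFiniteSupport ((negLap d ^ n) f) := by
  induction n with
  | zero => simpa using hf
  | succ n ih => rw [pow_succ']; exact negLap_hasFiniteSupport ih

lemma gridPair_negLap_pow_symm {d : ℕ} (n : ℕ) {f g : (Fin d → ℤ) → ℝ}
    (hf : HasFiniteSupport f) (hg : HasFiniteSupport g) :
    gridPair ((negLap d ^ n) f) g = gridPair ((negLap d ^ n) g) f := by
  induction n generalizing g with
  | zero => simp [gridPair_comm f g]
  | succ n ih =>
    have h1 : (negLap d ^ (n + 1)) f = negLap d ((negLap d ^ n) f) := by rw [pow_succ']; rfl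
    have h2 : (negLap d ^ (n + 1)) g = (negLap d ^ n) (negLap d g) := by rw [pow_succ]; rfl
    rw [h1, h2, gridPair_negLap_left (negLap_pow_hasFiniteSupport n hf) hg,
      ih (negLap_hasFiniteSupport hg)]

lemma gridPair_scaledLh_symm {d K : ℕ} (κ : ℕ → ℝ) {f g : (Fin d → ℤ) → ℝ}
    (hf : HasFiniteSupport f) (hg : HasFiniteSupport g) :
    gridPair (scaledLh d K κ f) g = gridPair (scaledLh d K κ g) f := by
  rw [gridPair_scaledLh κ f hg, gridPair_scaledLh κ g hf]
  exact Finset.sum_congr rfl fun i _ => by rw [gridPair_negLap_pow_symm i hf hg]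

lemma abs_negLap_pow_le {d : ℕ} (n : ℕ) {f : (Fin d → ℤ) → ℝ} {z : Fin d → ℤ} {ε : ℝ}
    (h : ∀ w : Fin d → ℤ, ∑ i, |w i - z i| ≤ (n : ℤ) → |f w| ≤ ε) :
    |(negLap d ^ n) f z| ≤ (4 * d) ^ n * ε := by
  induction n generalizing z with
  | zero => simpa using h z (by simp)
  | succ n ih =>
    have hnb (a : Fin d → ℤ) (ha : ∑ j, |a j| ≤ 1) :
        |(negLap d ^ n) f (z + a)| ≤ (4 * d) ^ n * ε := by
      refine ih fun w hw => h w ?_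
      have : ∑ j, |w j - z j| ≤ ∑ j, (|w j - (z + a) j| + |a j|) :=
        Finset.sum_le_sum fun j _ => by
          have := abs_add_le (w j - (z + a) j) (a j)
          rwa [Pi.add_apply, show w j - (z j + a j) + a j = w j - z j by ring] at this
      rw [Finset.sum_add_distrib] at this
      push_cast
      linarith
    have hs (i : Fin d) : ∑ j, |(Pi.single i 1 : Fin d → ℤ) j| ≤ 1 := by
      rw [Finset.sum_eq_single i] <;> simp +contextual
    have h1 : (negLap d ^ (n + 1)) f = negLap d ((negLap d ^ n) f) := by rw [pow_succ']; rfl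
    rw [h1]
    set g := (negLap d ^ n) f
    simp only [negLap, LinearMap.coe_mk, AddHom.coe_mk]
    refine (Finset.abs_sum_le_sum_abs _ _).trans ?_
    have hb (i : Fin d) : |2 * g z - g (z + Pi.single i 1) - g (z - Pi.single i 1)|
        ≤ 4 * ((4 * d) ^ n * ε) := by
      have a0 := abs_le.1 (hnb 0 (by simp))
      have a1 := abs_le.1 (hnb (Pi.single i 1) (hs i))
      have a2 := abs_le.1 (hnb (-Pi.single i 1) (by simpa using hs i))
      rw [add_zero] at a0
      rw [← sub_eq_add_neg] at a2
      rw [abs_le]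
      constructor <;> linarith [a0.1, a0.2, a1.1, a1.2, a2.1, a2.2]
    refine (Finset.sum_le_sum fun i _ => hb i).trans (le_of_eq ?_)
    simp only [Finset.sum_const, Finset.card_univ, Fintype.card_fin, nsmul_eq_mul]
    ring

lemma abs_scaledLh_le {d K : ℕ} {κ : ℕ → ℝ} (hκ : ∀ i ∈ Finset.Icc 1 K, 0 ≤ κ i)
    {f : (Fin d → ℤ) → ℝ} {z : Fin d → ℤ} {ε : ℝ}
    (h : ∀ w : Fin d → ℤ, ∑ i, |w i - z i| ≤ (K : ℤ) → |f w| ≤ ε) :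
    |scaledLh d K κ f z| ≤ scaledLhBound d K κ * ε := by
  rw [scaledLh_apply, Finset.sum_apply, scaledLhBound, Finset.sum_mul]
  refine (Finset.abs_sum_le_sum_abs _ _).trans (Finset.sum_le_sum fun i hi => ?_)
  have := hκ i hi
  rw [Pi.smul_apply, smul_eq_mul, abs_mul, abs_of_nonneg (by positivity), mul_assoc _ _ ε]
  refine mul_le_mul_of_nonneg_left (abs_negLap_pow_le i fun w hw => h w (hw.trans ?_))
    (by positivity)
  exact_mod_cast (Finset.mem_Icc.1 hi).2

lemma scaledLhBound_nonneg {d K : ℕ} {κ : ℕ → ℝ} (hκ : ∀ i ∈ Finset.Icc 1 K, 0 ≤ κ i) :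
    0 ≤ scaledLhBound d K κ :=
  Finset.sum_nonneg fun i hi => by have := hκ i hi; positivity

/-- The point of `ℝ^d` represented by the index `z`. -/
def gridPt {d : ℕ} (h : ℝ) (z : Fin d → ℤ) : Fin d → ℝ := fun i => h * (z i : ℝ)

lemma negLap_quadratic {d : ℕ} (h c : ℝ) (z : Fin d → ℤ) (ℓ : (Fin d → ℝ) →L[ℝ] ℝ)
    (B : (Fin d → ℝ) →L[ℝ] (Fin d → ℝ) →L[ℝ] ℝ) :
    negLap d (fun w => c + ℓ (gridPt h w - gridPt h z)
        + (1 / 2) * B (gridPt h w - gridPt h z) (gridPt h w - gridPt h z))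
      = fun _ => -(h ^ 2 * ∑ i, B (Pi.single i 1) (Pi.single i 1)) := by
  ext w
  have h1 (i : Fin d) : gridPt h (w + Pi.single i 1) - gridPt h z
      = (gridPt h w - gridPt h z) + h • Pi.single i (1 : ℝ) := by
    ext j
    by_cases hj : j = i
    · subst hj; simp [gridPt]; ring
    · simp [gridPt, hj]
  have h2 (i : Fin d) : gridPt h (w - Pi.single i 1) - gridPt h z
      = (gridPt h w - gridPt h z) - h • Pi.single i (1 : ℝ) := by
    ext j
    by_cases hj : j = i
    · subst hj; simp [gridPt]; ring
    · simp [gridPt, hj]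
  simp only [negLap, LinearMap.coe_mk, AddHom.coe_mk, h1, h2]
  generalize gridPt h w - gridPt h z = y
  simp only [map_add, map_sub, map_smul, add_apply, sub_apply, smul_apply, smul_eq_mul,
    Finset.mul_sum, ← Finset.sum_neg_distrib]
  exact Finset.sum_congr rfl fun i _ => by ring

lemma scaledLh_quadratic {d K : ℕ} {κ : ℕ → ℝ} (hK : 1 ≤ K) (hκ1 : κ 1 = 1) (h c : ℝ)
    (z : Fin d → ℤ) (ℓ : (Fin d → ℝ) →L[ℝ] ℝ) (B : (Fin d → ℝ) →L[ℝ] (Fin d → ℝ) →L[ℝ] ℝ) :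
    scaledLh d K κ (fun w => c + ℓ (gridPt h w - gridPt h z)
        + (1 / 2) * B (gridPt h w - gridPt h z) (gridPt h w - gridPt h z)) z
      = -(h ^ 2 * ∑ i, B (Pi.single i 1) (Pi.single i 1)) := by
  have h0 (b : ℝ) (n : ℕ) : (negLap d ^ (n + 1)) (fun _ => b) = 0 := by
    have : negLap d (fun _ => b) = 0 := by
      ext z; simp only [negLap, LinearMap.coe_mk, AddHom.coe_mk, Pi.zero_apply]
      exact Finset.sum_eq_zero fun i _ => by ring
    rw [pow_succ, Module.End.mul_apply, this, map_zero]
  rw [scaledLh_apply, Finset.sum_eq_single 1]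
  · simp only [hκ1, pow_one, negLap_quadratic]
    simp
  · intro i hi hi1
    obtain ⟨j, rfl⟩ : ∃ j, i = j + 1 + 1 :=
      ⟨i - 2, by have := (Finset.mem_Icc.1 hi).1; omega⟩
    rw [pow_succ, Module.End.mul_apply, negLap_quadratic, h0, smul_zero]
  · intro h
    exact absurd (Finset.mem_Icc.2 ⟨le_rfl, hK⟩) h

/-- The discrete energy estimate. -/
lemma gridPair_self_le_of_scaledLh {d K : ℕ} {κ : ℕ → ℝ} (hK : 1 ≤ K) (hκ1 : κ 1 = 1)
    (hκ : ∀ i ∈ Finset.Icc 1 K, 0 ≤ κ i) {w g : (Fin d → ℤ) → ℝ} (hg : HasFiniteSupport g)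
    (S : Finset (Fin d → ℤ)) (hS : ∀ z, w z ≠ 0 → z ∈ S) (i : Fin d) {N τ : ℝ} (hN0 : 0 ≤ N)
    (hN : ∀ z, w z ≠ 0 → |(z i : ℝ)| ≤ N)
    (hτ : ∀ z, w z ≠ 0 → |scaledLh d K κ (w + g) z| ≤ τ) :
    gridPair w w ≤ 64 * (N + 1) ^ 4 * (S.card * τ ^ 2)
      + 8 * scaledLhBound d K κ * (N + 1) ^ 2 * gridPair g g := by
  have hw : HasFiniteSupport w := S.finite_toSet.subset fun z hz => hS z hz
  have hwg : HasFiniteSupport (w + g) := hw.add hg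
  set c : ℝ := 1 / (4 * (N + 1) ^ 2) with hc
  have hN1 : 0 < N + 1 := by linarith
  have hc0 : 0 < c := by positivity
  set Q := gridPair (scaledLh d K κ w) w
  have hQ : c * gridPair w w ≤ Q := by
    have h1 := gridPair_self_le_gridDiff i hw hN
    have h2 : gridPair (gridDiff i w) (gridDiff i w) ≤ gridPair (negLap d w) w := by
      rw [gridPair_negLap_self hw]
      exact Finset.single_le_sum (f := fun i => gridPair (gridDiff i w) (gridDiff i w))
        (fun i _ => gridPair_self_nonneg _) (Finset.mem_univ i)
    have h3 := gridPair_negLap_le_scaledLh hK hκ1 hκ hw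
    rw [hc, div_mul_eq_mul_div, one_mul, div_le_iff₀ (by positivity)]
    refine h1.trans ?_
    rw [mul_comm]
    gcongr
    exact h2.trans h3
  have hsplit : gridPair (scaledLh d K κ (w + g)) w = Q + gridPair (scaledLh d K κ g) w := by
    rw [map_add, gridPair_add_left _ _ hw]
  have hpos := gridPair_scaledLh_nonneg hκ hwg
  rw [map_add, gridPair_add_left _ _ hwg, gridPair_comm _ (w + g), gridPair_comm _ (w + g),
    gridPair_comm, gridPair_comm (w + g)] at hpos
  have hadd (f : (Fin d → ℤ) → ℝ) : gridPair f (w + g) = gridPair f w + gridPair f g := by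
    simp only [gridPair, Pi.add_apply, mul_add]
    exact finsum_add_distrib (gridPair_hasFiniteSupport f hw) (gridPair_hasFiniteSupport f hg)
  rw [hadd, hadd, gridPair_scaledLh_symm κ hw hg] at hpos
  have hG := gridPair_scaledLh_le hκ hg
  have hres : gridPair (scaledLh d K κ (w + g)) w ≤ c / 4 * gridPair w w
      + S.card * (τ ^ 2 / c) := by
    have e1 : gridPair (scaledLh d K κ (w + g)) w = ∑ z ∈ S, scaledLh d K κ (w + g) z * w z :=
      finsum_eq_sum_of_support_subset _ fun z hz => hS z (right_ne_zero_of_mul hz)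
    have e2 : gridPair w w = ∑ z ∈ S, w z * w z :=
      finsum_eq_sum_of_support_subset _ fun z hz => hS z (right_ne_zero_of_mul hz)
    rw [e1, e2, Finset.mul_sum, ← nsmul_eq_mul, ← Finset.sum_const, ← Finset.sum_add_distrib]
    refine Finset.sum_le_sum fun z _ => ?_
    by_cases hz : w z = 0
    · rw [hz]; simp only [mul_zero, zero_add]; positivity
    · have h1 := hτ z hz
      have h2 : scaledLh d K κ (w + g) z ^ 2 ≤ τ ^ 2 := sq_le_sq' (abs_le.1 h1).1 (abs_le.1 h1).2
      set t := scaledLh d K κ (w + g) z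
      have h3 : t ^ 2 / c ≤ τ ^ 2 / c := by gcongr
      have h4 : c / 4 * (w z * w z) + t ^ 2 / c - t * w z = (c * w z / 2 - t) ^ 2 / c := by
        field_simp
        ring
      have h5 : 0 ≤ (c * w z / 2 - t) ^ 2 / c := by positivity
      linarith
  have fin : c / 4 * gridPair w w ≤ S.card * (τ ^ 2 / c)
      + (1 / 2) * (scaledLhBound d K κ * gridPair g g) := by linarith
  have : gridPair w w = 4 / c * (c / 4 * gridPair w w) := by field_simp
  rw [this]
  refine (mul_le_mul_of_nonneg_left fin (by positivity)).trans (le_of_eq ?_)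
  rw [hc]
  field_simp
  ring

section Geometry

lemma IsPreconnected.subset_of_disjoint_frontier {X : Type*} [TopologicalSpace X] {s D : Set X} (hs : IsPreconnected s)
    (hD : IsOpen D) (hne : (s ∩ D).Nonempty) (hfr : ∀ x ∈ s, x ∉ frontier D) : s ⊆ D := by
  refine hs.subset_of_closure_inter_subset hD hne fun x hx => ?_
  by_contra hxD
  exact hfr x hx.2 ⟨hx.1, by rwa [hD.interior_eq]⟩

variable {E G : Type*} [NormedAddCommGroup E] [NormedSpace ℝ E] [NormedAddCommGroup G]
  [NormedSpace ℝ G]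

lemma HasStrictFDerivAt.exists_ball_norm_sub_le {F : E → G} {F' : E →L[ℝ] G} {p : E}
    (h : HasStrictFDerivAt F F' p) {c : ℝ} (hc : 0 < c) :
    ∃ r > 0, ∀ x ∈ Metric.ball p r, ∀ y ∈ Metric.ball p r,
      ‖F y - F x - F' (y - x)‖ ≤ c * ‖y - x‖ := by
  have h1 := h.isLittleO.def hc
  rw [nhds_prod_eq] at h1
  obtain ⟨t, ht, hsub⟩ := (Filter.eventually_prod_self_iff (r := fun y x =>
    ‖F y - F x - F' (y - x)‖ ≤ c * ‖y - x‖)).1 h1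
  obtain ⟨r, hr, hrt⟩ := Metric.mem_nhds_iff.1 ht
  exact ⟨r, hr, fun x hx y hy => hsub y (hrt hy) x (hrt hx)⟩

/-- `x` and `y` are joined in `D` by three consecutive segments of length at most `C‖y - x‖`. -/
def ChainJoined (D : Set E) (C : ℝ) (x y : E) : Prop :=
  ∃ a b, segment ℝ x a ⊆ D ∧ segment ℝ a b ⊆ D ∧ segment ℝ b y ⊆ D ∧
    ‖a - x‖ ≤ C * ‖y - x‖ ∧ ‖b - a‖ ≤ C * ‖y - x‖ ∧ ‖y - b‖ ≤ C * ‖y - x‖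

lemma ChainJoined.mono {D : Set E} {C C' : ℝ} {x y : E} (h : ChainJoined D C x y) (hC : C ≤ C') :
    ChainJoined D C' x y := by
  obtain ⟨a, b, h1, h2, h3, h4, h5, h6⟩ := h
  have : C * ‖y - x‖ ≤ C' * ‖y - x‖ := by gcongr
  exact ⟨a, b, h1, h2, h3, h4.trans this, h5.trans this, h6.trans this⟩

lemma chainJoined_of_segment {D : Set E} {x y : E} (h : segment ℝ x y ⊆ D) :
    ChainJoined D 1 x y := by
  refine ⟨x, y, ?_, h, ?_, by simp, by simp, by simp⟩
  · simpa using h (left_mem_segment ℝ x y)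
  · simpa using h (right_mem_segment ℝ x y)

lemma exists_neg_of_ne_zero {F' : E →L[ℝ] ℝ} (h : F' ≠ 0) : ∃ v, F' v < 0 := by
  obtain ⟨w, hw⟩ : ∃ w, F' w ≠ 0 := by
    by_contra! h'
    exact h (ContinuousLinearMap.ext h')
  rcases hw.lt_or_gt with h1 | h1
  · exact ⟨w, h1⟩
  · exact ⟨-w, by simpa using h1⟩

lemma exists_chainJoined_near_frontier {F : E → ℝ} {F' : E →L[ℝ] ℝ} {p : E}
    (hF : HasStrictFDerivAt F F' p) (hF' : F' ≠ 0) :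
    ∃ ρ > 0, ∃ C, ∀ x y, F x < 0 → F y < 0 → x ∈ Metric.ball p ρ → y ∈ Metric.ball p ρ →
      ChainJoined {z | F z < 0} C x y := by
  obtain ⟨v, hv⟩ := exists_neg_of_ne_zero hF'
  set m := -F' v with hm
  have hm0 : 0 < m := by linarith
  have hv0 : v ≠ 0 := by rintro rfl; simp at hv
  have hvn : 0 < ‖v‖ := norm_pos_iff.2 hv0
  obtain ⟨r, hr, hb⟩ := hF.exists_ball_norm_sub_le (c := m / (2 * ‖v‖)) (by positivity)
  set L := ‖F'‖ + m / (2 * ‖v‖) with hL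
  have hL0 : 0 < L := by positivity
  have lip : ∀ x ∈ Metric.ball p r, ∀ y ∈ Metric.ball p r, F y - F x ≤ L * ‖y - x‖ := by
    intro x hx y hy
    have h1 := (abs_le.1 (hb x hx y hy)).2
    have h2 := (le_abs_self _).trans (F'.le_opNorm (y - x))
    rw [hL, add_mul]
    linarith
  have dec : ∀ x ∈ Metric.ball p r, ∀ t : ℝ, 0 ≤ t → x + t • v ∈ Metric.ball p r →
      F (x + t • v) ≤ F x - m / 2 * t := by
    intro x hx t ht hy
    have h1 := (abs_le.1 (hb x hx _ hy)).2
    rw [add_sub_cancel_left, map_smul, norm_smul, Real.norm_of_nonneg ht, smul_eq_mul] at h1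
    have h2 : m / (2 * ‖v‖) * (t * ‖v‖) = m / 2 * t := by field_simp
    rw [h2] at h1
    have h3 : F' v = -m := by rw [hm]; ring
    rw [h3] at h1
    linarith
  set T := 2 * L / m with hT
  have hT0 : 0 < T := by positivity
  set ρ := r / (2 * (1 + 2 * T * ‖v‖)) with hρ
  have hρ0 : 0 < ρ := by positivity
  have hρr : ρ + 2 * T * ‖v‖ * ρ < r := by
    have : ρ + 2 * T * ‖v‖ * ρ = r / 2 := by rw [hρ]; field_simp
    linarith
  refine ⟨ρ, hρ0, 1 + T * ‖v‖, fun x y hFx hFy hx hy => ?_⟩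
  set t := T * ‖y - x‖ with ht
  have ht0 : 0 ≤ t := by positivity
  have hxy : ‖y - x‖ < 2 * ρ := by
    rw [← dist_eq_norm]
    have := dist_triangle_right y x p
    rw [Metric.mem_ball] at hx hy
    linarith
  have inball : ∀ q ∈ Metric.ball p ρ, ∀ s, 0 ≤ s → s ≤ t → q + s • v ∈ Metric.ball p r := by
    intro q hq s hs hst
    rw [Metric.mem_ball, dist_eq_norm] at hq ⊢
    have h1 : ‖q + s • v - p‖ ≤ ‖q - p‖ + s * ‖v‖ := by
      rw [add_sub_right_comm]
      refine (norm_add_le _ _).trans ?_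
      rw [norm_smul, Real.norm_of_nonneg hs]
    have h2 : s * ‖v‖ ≤ 2 * T * ‖v‖ * ρ := by
      calc s * ‖v‖ ≤ t * ‖v‖ := by gcongr
        _ ≤ T * (2 * ρ) * ‖v‖ := by rw [ht]; gcongr
        _ = _ := by ring
    linarith
  have inr : ∀ q ∈ Metric.ball p ρ, q ∈ Metric.ball p r := fun q hq => by
    simpa using inball q hq 0 le_rfl ht0
  have leg : ∀ q ∈ Metric.ball p ρ, F q < 0 → segment ℝ q (q + t • v) ⊆ {z | F z < 0} := by
    intro q hq hFq z hz
    obtain ⟨θ, hθ, rfl⟩ := (segment_eq_image' ℝ q (q + t • v)) ▸ hz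
    show F (q + θ • (q + t • v - q)) < 0
    rw [add_sub_cancel_left, smul_smul]
    have h1 : θ * t ≤ t := mul_le_of_le_one_left ht0 hθ.2
    have h0 : 0 ≤ θ * t := mul_nonneg hθ.1 ht0
    have h2 := dec q (inr q hq) (θ * t) h0 (inball q hq _ h0 h1)
    have h3 : 0 ≤ m / 2 * (θ * t) := by positivity
    linarith
  have hlen : t * ‖v‖ ≤ (1 + T * ‖v‖) * ‖y - x‖ := by
    rw [ht]
    nlinarith [norm_nonneg (y - x)]
  refine ⟨x + t • v, y + t • v, leg x hx hFx, ?_, ?_, ?_, ?_, ?_⟩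
  · intro z hz
    obtain ⟨θ, hθ, rfl⟩ := (segment_eq_image' ℝ (x + t • v) (y + t • v)) ▸ hz
    have hq : x + θ • (y - x) ∈ Metric.ball p ρ := by
      refine (convex_ball p ρ).segment_subset hx hy ?_
      rw [segment_eq_image']
      exact ⟨θ, hθ, rfl⟩
    have e : x + t • v + θ • (y + t • v - (x + t • v)) = (x + θ • (y - x)) + t • v := by
      rw [add_sub_add_right_eq_sub]; abel
    show F (x + t • v + θ • (y + t • v - (x + t • v))) < 0
    rw [e]
    have h1 := dec _ (inr _ hq) t ht0 (inball _ hq t ht0 le_rfl)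
    have h2 := lip x (inr x hx) _ (inr _ hq)
    rw [add_sub_cancel_left, norm_smul, Real.norm_of_nonneg hθ.1] at h2
    have h3 : L * (θ * ‖y - x‖) ≤ L * ‖y - x‖ := by
      gcongr
      exact mul_le_of_le_one_left (norm_nonneg _) hθ.2
    have h4 : m / 2 * t = L * ‖y - x‖ := by rw [ht, hT]; field_simp
    linarith
  · rw [segment_symm]
    exact leg y hy hFy
  · rw [add_sub_cancel_left, norm_smul, Real.norm_of_nonneg ht0]
    exact hlen
  · rw [add_sub_add_right_eq_sub]
    have : 0 ≤ T * ‖v‖ * ‖y - x‖ := by positivity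
    linarith
  · rw [sub_add_cancel_left, norm_neg, norm_smul, Real.norm_of_nonneg ht0]
    exact hlen

lemma exists_chainJoined_of_isCompact {D : Set E} (hDo : IsOpen D)
    (hDc : IsCompact (closure D)) {F : E → ℝ} (hF : ContDiff ℝ 2 F) (hDF : D = {x | F x < 0})
    (hgrad : ∀ x ∈ frontier D, fderiv ℝ F x ≠ 0) :
    ∃ δ > 0, ∃ C, 0 ≤ C ∧ ∀ x ∈ D, ∀ y ∈ D, ‖y - x‖ < δ → ChainJoined D C x y := by
  have key : ∃ δ > 0, ∃ C, 0 ≤ C ∧ ∀ x ∈ closure D, ∀ y, x ∈ D → y ∈ D → ‖y - x‖ < δ →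
      ChainJoined D C x y := by
    refine hDc.induction_on (p := fun s => ∃ δ > 0, ∃ C, 0 ≤ C ∧ ∀ x ∈ s, ∀ y, x ∈ D → y ∈ D →
      ‖y - x‖ < δ → ChainJoined D C x y) ?_ ?_ ?_ ?_
    · exact ⟨1, one_pos, 0, le_rfl, fun x hx => absurd hx (Set.notMem_empty x)⟩
    · rintro s t hst ⟨δ, hδ, C, hC, h⟩
      exact ⟨δ, hδ, C, hC, fun x hx => h x (hst hx)⟩
    · rintro s t ⟨δ, hδ, C, hC, h⟩ ⟨δ', hδ', C', hC', h'⟩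
      refine ⟨min δ δ', lt_min hδ hδ', max C C', le_max_of_le_left hC,
        fun x hx y hxD hyD hxy => ?_⟩
      rcases hx with hx | hx
      · exact (h x hx y hxD hyD (hxy.trans_le (min_le_left _ _))).mono (le_max_left _ _)
      · exact (h' x hx y hxD hyD (hxy.trans_le (min_le_right _ _))).mono (le_max_right _ _)
    · intro p hp
      obtain ⟨ρ, hρ, C, hC⟩ : ∃ ρ > 0, ∃ C, ∀ x y, x ∈ D → y ∈ D → x ∈ Metric.ball p ρ →
          y ∈ Metric.ball p ρ → ChainJoined D C x y := by
        by_cases hpD : p ∈ D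
        · obtain ⟨ρ, hρ, hsub⟩ := Metric.isOpen_iff.1 hDo p hpD
          exact ⟨ρ, hρ, 1, fun x y _ _ hx hy => chainJoined_of_segment
            (((convex_ball p ρ).segment_subset hx hy).trans hsub)⟩
        · have hpf : p ∈ frontier D := ⟨hp, by rwa [hDo.interior_eq]⟩
          obtain ⟨ρ, hρ, C, h⟩ := exists_chainJoined_near_frontier
            (hF.contDiffAt.hasStrictFDerivAt two_ne_zero) (hgrad p hpf)
          subst hDF
          exact ⟨ρ, hρ, C, h⟩
      refine ⟨Metric.ball p (ρ / 2), mem_nhdsWithin_of_mem_nhds (Metric.ball_mem_nhds p (by linarith)),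
        ρ / 2, by linarith, max C 0, le_max_right _ _, fun x hx y hxD hyD hxy =>
        (hC x y hxD hyD (Metric.ball_subset_ball (by linarith) hx) ?_).mono (le_max_left _ _)⟩
      rw [Metric.mem_ball] at hx ⊢
      have := dist_triangle y x p
      rw [← dist_eq_norm] at hxy
      linarith
  obtain ⟨δ, hδ, C, hC, h⟩ := key
  exact ⟨δ, hδ, C, hC, fun x hx y hy => h x (subset_closure hx) y hx hy⟩

lemma norm_le_of_segment {w : E → G} {w' : E → E →L[ℝ] G} {x y : E} {ε ℓ : ℝ}
    (hw : ∀ q ∈ segment ℝ x y, HasFDerivAt w (w' q) q) (hε : ∀ q ∈ segment ℝ x y, ‖w' q‖ ≤ ε)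
    (hℓ : ‖y - x‖ ≤ ℓ) : ∀ q ∈ segment ℝ x y, ‖w q - w x‖ ≤ ε * ℓ := by
  intro q hq
  have h0 : 0 ≤ ε := (norm_nonneg _).trans (hε q hq)
  refine ((convex_segment x y).norm_image_sub_le_of_norm_hasFDerivWithin_le (𝕜 := ℝ)
    (fun z hz => (hw z hz).hasFDerivWithinAt) hε (left_mem_segment ℝ x y) hq).trans ?_
  gcongr
  exact (norm_sub_le_of_mem_segment hq).trans hℓ

lemma norm_le_of_chain {w : E → G} {w' : E → E →L[ℝ] G} {x a b y : E} {ε ℓ : ℝ}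
    (hw : ∀ q ∈ segment ℝ x a ∪ segment ℝ a b ∪ segment ℝ b y, HasFDerivAt w (w' q) q)
    (hε : ∀ q ∈ segment ℝ x a ∪ segment ℝ a b ∪ segment ℝ b y, ‖w' q‖ ≤ ε)
    (h1 : ‖a - x‖ ≤ ℓ) (h2 : ‖b - a‖ ≤ ℓ) (h3 : ‖y - b‖ ≤ ℓ) (hx : w x = 0) :
    ∀ q ∈ segment ℝ x a ∪ segment ℝ a b ∪ segment ℝ b y, ‖w q‖ ≤ ε * (3 * ℓ) := by
  have hε0 : 0 ≤ ε := (norm_nonneg _).trans (hε x (.inl (.inl (left_mem_segment ℝ x a))))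
  have hℓ0 : 0 ≤ ℓ := (norm_nonneg _).trans h1
  have hp : 0 ≤ ε * ℓ := by positivity
  have k1 := norm_le_of_segment (fun q hq => hw q (.inl (.inl hq)))
    (fun q hq => hε q (.inl (.inl hq))) h1
  have k2 := norm_le_of_segment (fun q hq => hw q (.inl (.inr hq)))
    (fun q hq => hε q (.inl (.inr hq))) h2
  have k3 := norm_le_of_segment (fun q hq => hw q (.inr hq))
    (fun q hq => hε q (.inr hq)) h3
  have ka := k1 a (right_mem_segment ℝ x a)
  rw [hx, sub_zero] at ka
  have kb := (norm_le_norm_add_norm_sub' (w b) (w a)).trans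
    (add_le_add ka (k2 b (right_mem_segment ℝ a b)))
  rintro q ((hq | hq) | hq)
  · have := k1 q hq
    rw [hx, sub_zero] at this
    linarith
  · have := (norm_le_norm_add_norm_sub' (w q) (w a)).trans (add_le_add ka (k2 q hq))
    linarith
  · have := (norm_le_norm_add_norm_sub' (w q) (w b)).trans (add_le_add kb (k3 q hq))
    linarith

lemma abs_taylor_two_le {D : Set E} (hDo : IsOpen D) {u : E → ℝ} (hu : ContDiffOn ℝ 3 u D)
    {M C : ℝ} (hM : ∀ x ∈ D, ‖iteratedFDeriv ℝ 3 u x‖ ≤ M) {x y : E}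
    (h : ChainJoined D C x y) :
    |u y - (u x + fderiv ℝ u x (y - x) + (1 / 2) * fderiv ℝ (fderiv ℝ u) x (y - x) (y - x))|
      ≤ M * (3 * (C * ‖y - x‖)) ^ 3 := by
  obtain ⟨a, b, s1, s2, s3, h1, h2, h3⟩ := h
  have hΓ : segment ℝ x a ∪ segment ℝ a b ∪ segment ℝ b y ⊆ D :=
    Set.union_subset (Set.union_subset s1 s2) s3
  set Γ := segment ℝ x a ∪ segment ℝ a b ∪ segment ℝ b y
  have hu3 (q : E) (hq : q ∈ D) : ContDiffAt ℝ 3 u q := hu.contDiffAt (hDo.mem_nhds hq)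
  have hu2 (q : E) (hq : q ∈ D) : ContDiffAt ℝ 2 (fderiv ℝ u) q :=
    (hu3 q hq).fderiv_right (by norm_num)
  have hu1 (q : E) (hq : q ∈ D) : ContDiffAt ℝ 1 (fderiv ℝ (fderiv ℝ u)) q :=
    (hu2 q hq).fderiv_right (by norm_num)
  set ℓ := C * ‖y - x‖
  have hxD : x ∈ D := s1 (left_mem_segment ℝ x a)
  set B := fderiv ℝ (fderiv ℝ u) x with hB
  have b2 : ∀ q ∈ Γ, ‖fderiv ℝ (fderiv ℝ u) q - B‖ ≤ M * (3 * ℓ) := by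
    refine norm_le_of_chain (w' := fun q => fderiv ℝ (fderiv ℝ (fderiv ℝ u)) q)
      (fun q hq => ?_) (fun q hq => ?_) h1 h2 h3 (by simp [hB])
    · exact ((hu1 q (hΓ hq)).differentiableAt one_ne_zero).hasFDerivAt.sub_const _
    · refine le_trans (le_of_eq ?_) (hM q (hΓ hq))
      rw [← norm_iteratedFDeriv_fderiv, ← norm_iteratedFDeriv_fderiv, ← norm_iteratedFDeriv_fderiv,
        norm_iteratedFDeriv_zero]
  have b1 : ∀ q ∈ Γ, ‖fderiv ℝ u q - (fderiv ℝ u x + B (q - x))‖ ≤ M * (3 * ℓ) * (3 * ℓ) := by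
    refine norm_le_of_chain (w' := fun q => fderiv ℝ (fderiv ℝ u) q - B)
      (fun q hq => ?_) b2 h1 h2 h3 (by simp)
    refine ((hu2 q (hΓ hq)).differentiableAt two_ne_zero).hasFDerivAt.sub ?_
    exact (B.hasFDerivAt.comp q ((hasFDerivAt_id q).sub_const x)).const_add _
  have hsymm : ∀ v w, B v w = B w v := by
    have := (hu3 x hxD).isSymmSndFDerivAt
      (by rw [minSmoothness_of_isRCLikeNormedField]; norm_num)
    exact fun v w => this.eq v w
  have b0 : ∀ q ∈ Γ, ‖u q - (u x + fderiv ℝ u x (q - x) + (1 / 2) * B (q - x) (q - x))‖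
      ≤ M * (3 * ℓ) * (3 * ℓ) * (3 * ℓ) := by
    refine norm_le_of_chain (w' := fun q => fderiv ℝ u q - (fderiv ℝ u x + B (q - x)))
      (fun q hq => ?_) b1 h1 h2 h3 (by simp)
    refine ((hu3 q (hΓ hq)).differentiableAt three_ne_zero).hasFDerivAt.sub ?_
    have e1 : HasFDerivAt (fun q => q - x) (ContinuousLinearMap.id ℝ E) q :=
      (hasFDerivAt_id q).sub_const x
    have e2 := (B.hasFDerivAt.comp q e1).clm_apply e1
    have e3 := (((fderiv ℝ u x).hasFDerivAt.comp q e1).const_add (u x)).add (e2.const_mul (1 / 2))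
    refine e3.congr_fderiv ?_
    ext v
    simp
    rw [hsymm v q, hsymm v x]
    ring
  have := b0 y (.inr (right_mem_segment ℝ b y))
  rw [Real.norm_eq_abs] at this
  exact this.trans (le_of_eq (by ring))

lemma exists_norm_iteratedFDeriv_le {D : Set E} (hDo : IsOpen D) (hDc : IsCompact (closure D))
    {u : E → G} {n j : ℕ} (hu : ContDiffOn ℝ n u (closure D)) (hj : j ≤ n) :
    ∃ M, ∀ x ∈ D, ‖iteratedFDeriv ℝ j u x‖ ≤ M := by
  have key : ∃ M, ∀ x ∈ closure D, x ∈ D → ‖iteratedFDeriv ℝ j u x‖ ≤ M := by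
    refine hDc.induction_on (p := fun s => ∃ M, ∀ x ∈ s, x ∈ D → ‖iteratedFDeriv ℝ j u x‖ ≤ M)
      ⟨0, fun x hx => absurd hx (Set.notMem_empty x)⟩ ?_ ?_ ?_
    · rintro s t hst ⟨M, h⟩
      exact ⟨M, fun x hx => h x (hst hx)⟩
    · rintro s t ⟨M, h⟩ ⟨M', h'⟩
      refine ⟨max M M', fun x hx hxD => ?_⟩
      rcases hx with hx | hx
      · exact (h x hx hxD).trans (le_max_left _ _)
      · exact (h' x hx hxD).trans (le_max_right _ _)
    · intro p hp
      obtain ⟨v, hv, P, hP⟩ := contDiffWithinAt_nat.1 (hu p hp)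
      rw [Set.insert_eq_of_mem hp] at hv
      have hpv : p ∈ v := mem_of_mem_nhdsWithin hp hv
      have hc : ContinuousWithinAt (fun x => P x j) v p := hP.cont j (by exact_mod_cast hj) p hpv
      have hc' : ∀ᶠ x in nhdsWithin p (closure D), ‖P x j‖ < ‖P p j‖ + 1 :=
        (hc.mono_of_mem_nhdsWithin hv).norm.eventually_lt_const (by linarith)
      obtain ⟨O, hO, hpO, hOv⟩ := mem_nhdsWithin.1 hv
      refine ⟨_, Filter.inter_mem hc' (mem_nhdsWithin_of_mem_nhds (hO.mem_nhds hpO)),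
        ‖P p j‖ + 1, fun x hx hxD => ?_⟩
      have hOD : IsOpen (O ∩ D) := hO.inter hDo
      have hsub : O ∩ D ⊆ v := fun z hz => hOv ⟨hz.1, subset_closure hz.2⟩
      have e := (hP.mono hsub).eq_iteratedFDerivWithin_of_uniqueDiffOn
        (m := j) (by exact_mod_cast hj) hOD.uniqueDiffOn ⟨hx.2, hxD⟩
      rw [iteratedFDerivWithin_of_isOpen j hOD ⟨hx.2, hxD⟩] at e
      rw [← e]
      exact le_of_lt hx.1
  obtain ⟨M, hM⟩ := key
  exact ⟨M, fun x hx => hM x (subset_closure hx) hx⟩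

/-- A point of `closure D` at distance at most `ρ` of the complement is within `ρ` of the
frontier, and a function vanishing on the frontier is small there. -/
lemma exists_frontier_norm_le [ProperSpace E] {D : Set E} (hDo : IsOpen D) {u : E → G}
    (hu : ContinuousOn u (closure D)) (hud : ∀ x ∈ D, DifferentiableAt ℝ u x)
    (hu0 : ∀ x ∈ frontier D, u x = 0) {M : ℝ} (hM0 : 0 ≤ M) (hM : ∀ x ∈ D, ‖fderiv ℝ u x‖ ≤ M)
    {x y : E} (hx : x ∈ closure D) (hy : y ∉ closure D) :
    (∃ p ∈ frontier D, ‖x - p‖ ≤ ‖y - x‖) ∧ ‖u x‖ ≤ M * ‖y - x‖ := by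
  by_cases hxf : x ∈ frontier D
  · exact ⟨⟨x, hxf, by simp⟩, by rw [hu0 x hxf, norm_zero]; positivity⟩
  have hxD : x ∈ D := by
    by_contra h
    exact hxf ⟨hx, by rwa [hDo.interior_eq]⟩
  have meet : ∀ z ∉ D, ∃ q ∈ frontier D, ‖q - x‖ ≤ ‖z - x‖ := by
    intro z hz
    by_contra! hcon
    refine hz ((convex_segment x z).isPreconnected.subset_of_disjoint_frontier hDo
      ⟨x, left_mem_segment ℝ x z, hxD⟩ (fun q hq hqf => ?_) (right_mem_segment ℝ x z))
    exact (hcon q hqf).not_ge (norm_sub_le_of_mem_segment hq)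
  obtain ⟨q, hq, hqy⟩ := meet y fun h => hy (subset_closure h)
  obtain ⟨p, hp, hpx⟩ := isClosed_frontier.exists_infDist_eq_dist ⟨q, hq⟩ x
  have hmin : ∀ z ∈ frontier D, ‖p - x‖ ≤ ‖z - x‖ := fun z hz => by
    rw [← dist_eq_norm, ← dist_eq_norm, dist_comm, ← hpx, dist_comm z]
    exact Metric.infDist_le_dist_of_mem hz
  have hle : ‖p - x‖ ≤ ‖y - x‖ := (hmin q hq).trans hqy
  refine ⟨⟨p, hp, by rwa [norm_sub_rev]⟩, ?_⟩
  set ρ := ‖p - x‖ with hρ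
  have hρ0 : ρ ≠ 0 := fun h => hxf (by rwa [← sub_eq_zero.1 (norm_eq_zero.1 h)])
  have hball : Metric.ball x ρ ⊆ D := by
    intro z hz
    by_contra hzD
    obtain ⟨q, hq, hqz⟩ := meet z hzD
    rw [Metric.mem_ball, dist_eq_norm] at hz
    linarith [hmin q hq]
  have hρpos : 0 < ρ := lt_of_le_of_ne (norm_nonneg _) hρ0.symm
  have hb : ∀ z ∈ Metric.ball x ρ, ‖u z - u x‖ ≤ M * ρ := by
    intro z hz
    refine ((convex_ball x ρ).norm_image_sub_le_of_norm_fderiv_le (𝕜 := ℝ)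
      (fun w hw => hud w (hball hw)) (fun w hw => hM w (hball hw))
      (Metric.mem_ball_self hρpos) hz).trans ?_
    gcongr
    rw [Metric.mem_ball, dist_eq_norm] at hz
    exact hz.le
  have hpc : p ∈ closure (Metric.ball x ρ) := by
    rw [closure_ball x hρ0, Metric.mem_closedBall, dist_eq_norm]
  have hcont : ContinuousWithinAt u (Metric.ball x ρ) p :=
    (hu p (frontier_subset_closure hp)).mono (hball.trans subset_closure)
  have := ContinuousWithinAt.closure_le hpc (hcont.sub continuousWithinAt_const).norm
    continuousWithinAt_const hb
  change ‖u p - u x‖ ≤ M * ρ at this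
  rw [hu0 p hp, zero_sub, norm_neg] at this
  exact this.trans (by gcongr)

end Geometry

section Mk

lemma iSup_mem_nonneg {α : Type*} {D : Set α} {g : α → ℝ} (hg : ∀ x, 0 ≤ g x) :
    0 ≤ ⨆ x ∈ D, g x :=
  Real.iSup_nonneg fun x => Real.iSup_nonneg fun _ => hg x

lemma le_iSup_mem {α : Type*} {D : Set α} {g : α → ℝ} {M : ℝ}
    (hM : ∀ x ∈ D, g x ≤ M) {x : α} (hx : x ∈ D) : g x ≤ ⨆ x ∈ D, g x := by
  have hb : BddAbove (Set.range fun x => ⨆ _ : x ∈ D, g x) := by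
    refine ⟨max M 0, ?_⟩
    rintro _ ⟨y, rfl⟩
    exact Real.iSup_le (fun hy => (hM y hy).trans (le_max_left _ _)) (le_max_right _ _)
  refine le_trans (le_of_eq ?_) (le_ciSup hb x)
  exact (ciSup_pos (f := fun _ : x ∈ D => g x) hx).symm

lemma Mk_nonneg (d : ℕ) (D : Set (Fin d → ℝ)) (u : (Fin d → ℝ) → ℝ) (k : ℕ) :
    0 ≤ Mk d D u k :=
  Finset.sum_nonneg fun _ _ => iSup_mem_nonneg fun _ => norm_nonneg _

lemma norm_iteratedFDeriv_le_Mk {d n j k : ℕ} {D : Set (Fin d → ℝ)} (hDo : IsOpen D)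
    (hDc : IsCompact (closure D)) {u : (Fin d → ℝ) → ℝ} (hu : ContDiffOn ℝ n u (closure D))
    (hjn : j ≤ n) (hjk : j ≤ k) {x : Fin d → ℝ} (hx : x ∈ D) :
    ‖iteratedFDeriv ℝ j u x‖ ≤ Mk d D u k := by
  obtain ⟨M, hM⟩ := exists_norm_iteratedFDeriv_le hDo hDc hu hjn
  refine (le_iSup_mem hM hx).trans ?_
  exact Finset.single_le_sum (f := fun j => ⨆ x ∈ D, ‖iteratedFDeriv ℝ j u x‖)
    (fun _ _ => iSup_mem_nonneg fun _ => norm_nonneg _) (Finset.mem_range.2 (by omega))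

lemma contLap_eq (d : ℕ) (u : (Fin d → ℝ) → ℝ) (x : Fin d → ℝ) :
    contLap d u x = ∑ i, fderiv ℝ (fderiv ℝ u) x (Pi.single i 1) (Pi.single i 1) := by
  simp only [contLap, iteratedFDeriv_two_apply]

end Mk

section Boundary

variable {d : ℕ}

lemma exists_single_ne_zero {F' : (Fin d → ℝ) →L[ℝ] ℝ} (h : F' ≠ 0) :
    ∃ i, F' (Pi.single i 1) ≠ 0 := by
  by_contra! h'
  refine h (ContinuousLinearMap.ext fun v => ?_)
  have := F'.toLinearMap.pi_apply_eq_sum_univ v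
  simp only [ContinuousLinearMap.coe_coe] at this
  rw [this]
  refine Finset.sum_eq_zero fun i _ => ?_
  have e : (fun j => if i = j then (1 : ℝ) else 0) = Pi.single i 1 := by
    ext j; simp [Pi.single_apply, eq_comm]
  rw [e, h', smul_zero]

lemma exists_step_notMem_closure {D : Set (Fin d → ℝ)} (hDc : IsCompact (closure D))
    {F : (Fin d → ℝ) → ℝ} (hF : ContDiff ℝ 2 F) (hDF : D = {x | F x < 0})
    (hfr : frontier D = {x | F x = 0}) (hgrad : ∀ x ∈ frontier D, fderiv ℝ F x ≠ 0) :
    ∃ δ > 0, ∀ x ∈ frontier D, ∀ h : ℝ, 0 < h → h < δ → ∃ i, ∃ σ : ℤ, |σ| = 1 ∧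
      x + h • Pi.single i (σ : ℝ) ∉ closure D := by
  have hcl : closure D ⊆ {x | F x ≤ 0} := by
    refine closure_minimal ?_ (isClosed_le hF.continuous continuous_const)
    rw [hDF]
    exact fun x (hx : F x < 0) => hx.le
  have hfc : IsCompact (frontier D) := hDc.of_isClosed_subset isClosed_frontier
    frontier_subset_closure
  have key : ∃ δ > 0, ∀ x ∈ frontier D, F x = 0 → ∀ h : ℝ, 0 < h → h < δ → ∃ i, ∃ σ : ℤ,
      |σ| = 1 ∧ x + h • Pi.single i (σ : ℝ) ∉ closure D := by
    refine hfc.induction_on (p := fun s => ∃ δ > 0, ∀ x ∈ s, F x = 0 → ∀ h : ℝ, 0 < h → h < δ →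
      ∃ i, ∃ σ : ℤ, |σ| = 1 ∧ x + h • Pi.single i (σ : ℝ) ∉ closure D)
      ⟨1, one_pos, fun x hx => absurd hx (Set.notMem_empty x)⟩ ?_ ?_ ?_
    · rintro s t hst ⟨δ, hδ, H⟩
      exact ⟨δ, hδ, fun x hx => H x (hst hx)⟩
    · rintro s t ⟨δ, hδ, H⟩ ⟨δ', hδ', H'⟩
      refine ⟨min δ δ', lt_min hδ hδ', fun x hx hxF h h0 hh => ?_⟩
      rcases hx with hx | hx
      · exact H x hx hxF h h0 (hh.trans_le (min_le_left _ _))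
      · exact H' x hx hxF h h0 (hh.trans_le (min_le_right _ _))
    · intro p hp
      obtain ⟨i, hi⟩ := exists_single_ne_zero (hgrad p hp)
      obtain ⟨σ, hσ, hm⟩ : ∃ σ : ℤ, |σ| = 1 ∧ 0 < fderiv ℝ F p (Pi.single i (σ : ℝ)) := by
        rcases hi.lt_or_gt with h | h
        · refine ⟨-1, by simp, ?_⟩
          push_cast
          rw [Pi.single_neg, map_neg]
          linarith
        · exact ⟨1, by simp, by simpa using h⟩
      set m := fderiv ℝ F p (Pi.single i (σ : ℝ)) with hmdef
      obtain ⟨r, hr, hb⟩ := (hF.contDiffAt.hasStrictFDerivAt two_ne_zero :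
        HasStrictFDerivAt F (fderiv ℝ F p) p).exists_ball_norm_sub_le (half_pos hm)
      refine ⟨_, mem_nhdsWithin_of_mem_nhds (Metric.ball_mem_nhds p (half_pos hr)),
        r / 2, half_pos hr, fun x hx hxF h h0 hh => ⟨i, σ, hσ, fun hcon => ?_⟩⟩
      have hn : ‖h • (Pi.single i (σ : ℝ) : Fin d → ℝ)‖ = h := by
        rw [norm_smul, Pi.norm_single, Real.norm_of_nonneg h0.le, Real.norm_eq_abs,
          ← Int.cast_abs, hσ]
        simp
      have h1 := hb x (Metric.ball_subset_ball (by linarith) hx)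
        (x + h • Pi.single i (σ : ℝ)) (by
          rw [Metric.mem_ball] at hx ⊢
          have := dist_triangle (x + h • (Pi.single i (σ : ℝ) : Fin d → ℝ)) x p
          rw [dist_self_add_left, hn] at this
          linarith)
      rw [add_sub_cancel_left, hn, map_smul, ← hmdef, hxF, sub_zero, smul_eq_mul] at h1
      have h2 := (abs_le.1 h1).1
      have h3 : F (x + h • Pi.single i (σ : ℝ)) ≤ 0 := hcl hcon
      nlinarith
  obtain ⟨δ, hδ, H⟩ := key
  exact ⟨δ, hδ, fun x hx => H x hx (by rw [hfr] at hx; exact hx)⟩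

lemma gridPt_add_single (h : ℝ) (z : Fin d → ℤ) (i : Fin d) (σ : ℤ) :
    gridPt h (z + Pi.single i σ) = gridPt h z + h • Pi.single i (σ : ℝ) := by
  ext j
  by_cases hj : j = i
  · subst hj; simp [gridPt, mul_add]
  · simp [gridPt, hj]

lemma exists_forall_Rh_mem {K : ℕ} (hK : 1 ≤ K) {D : Set (Fin d → ℝ)}
    (hDo : IsOpen D) (hDc : IsCompact (closure D))
    {F : (Fin d → ℝ) → ℝ} (hF : ContDiff ℝ 2 F) (hDF : D = {x | F x < 0})
    (hfr : frontier D = {x | F x = 0}) (hgrad : ∀ x ∈ frontier D, fderiv ℝ F x ≠ 0) :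
    ∃ δ > 0, ∀ h : ℝ, 0 < h → h < δ → ∀ z ∈ Rh d D K h, gridPt h z ∈ D := by
  obtain ⟨δ, hδ, H⟩ := exists_step_notMem_closure hDc hF hDF hfr hgrad
  refine ⟨δ, hδ, fun h h0 hh z hz => ?_⟩
  by_contra hzD
  obtain ⟨i, σ, hσ, hn⟩ := H (gridPt h z) ⟨hz.1, by rwa [hDo.interior_eq]⟩ h h0 hh
  rw [← gridPt_add_single] at hn
  refine hn (hz.2 (z + Pi.single i σ) ?_)
  rw [Finset.sum_eq_single i]
  · simpa [hσ] using hK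
  · intro j _ hj
    simp [hj]
  · simp

end Boundary

section Counting

lemma card_le_of_abs_sub_le {ι : Type*} [Fintype ι] (S : Finset (ι → ℤ)) {c : ι → ℝ} {r h : ℝ}
    (hr : 0 ≤ r) (h0 : 0 < h) (h1 : h ≤ 1) (hS : ∀ z ∈ S, ∀ j, |h * (z j : ℝ) - c j| ≤ r) :
    (S.card : ℝ) ≤ ((2 * r + 1) / h) ^ Fintype.card ι := by
  classical
  have hsub : S ⊆ Fintype.piFinset fun j => Finset.Icc ⌈(c j - r) / h⌉ ⌊(c j + r) / h⌋ := by
    intro z hz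
    rw [Fintype.mem_piFinset]
    intro j
    obtain ⟨ha, hb⟩ := abs_le.1 (hS z hz j)
    rw [Finset.mem_Icc, Int.ceil_le, Int.le_floor, div_le_iff₀ h0, le_div_iff₀ h0]
    constructor <;> linarith
  have hcard := Finset.card_le_card hsub
  rw [Fintype.card_piFinset] at hcard
  calc (S.card : ℝ) ≤ ∏ j, ((Finset.Icc ⌈(c j - r) / h⌉ ⌊(c j + r) / h⌋).card : ℝ) := by
        exact_mod_cast hcard
    _ ≤ ∏ _j : ι, (2 * r + 1) / h := by
        refine Finset.prod_le_prod (fun _ _ => by positivity) fun j _ => ?_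
        rw [Int.card_Icc]
        have e : (((⌊(c j + r) / h⌋ + 1 - ⌈(c j - r) / h⌉).toNat : ℤ) : ℝ) ≤ (2 * r + 1) / h := by
          rw [Int.toNat_eq_max, Int.cast_max]
          refine max_le ?_ (by push_cast; positivity)
          push_cast
          have := Int.floor_le ((c j + r) / h)
          have := Int.le_ceil ((c j - r) / h)
          have e1 : (2 * r + 1) / h = (c j + r) / h - (c j - r) / h + 1 / h := by ring
          have : 1 ≤ 1 / h := by rw [le_div_iff₀ h0]; linarith
          linarith
        exact_mod_cast e
    _ = _ := by simp [div_pow]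

variable {d : ℕ}

lemma card_near_frontier_le_local (K : ℕ) {F : (Fin d → ℝ) → ℝ} {F' : (Fin d → ℝ) →L[ℝ] ℝ}
    {p : Fin d → ℝ} (hF : HasStrictFDerivAt F F' p) (hF' : F' ≠ 0) :
    ∃ ρ > 0, ∃ δ > 0, ∃ C : ℝ, ∀ h : ℝ, 0 < h → h < δ → ∀ S : Finset (Fin d → ℤ),
      (∀ z ∈ S, ∃ q ∈ Metric.ball p ρ, F q = 0 ∧ ‖gridPt h z - q‖ ≤ K * h) →
      S.card * h ^ d ≤ C * h := by
  classical
  obtain ⟨i, hi⟩ := exists_single_ne_zero hF'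
  set m := |F' (Pi.single i 1)| with hm
  have hm0 : 0 < m := abs_pos.2 hi
  obtain ⟨r, hr, hb⟩ := hF.exists_ball_norm_sub_le (half_pos hm0)
  set L := ‖F'‖ + m / 2 with hL
  have hL0 : 0 < L := by positivity
  set A := 4 * L * K / m with hA
  have hA0 : 0 ≤ A := by positivity
  refine ⟨r / 2, half_pos hr, min 1 (r / (2 * (K + 1))), lt_min one_pos (by positivity),
    (2 * ⌊A⌋₊ + 1 : ℕ) * (2 * r + 1) ^ (d - 1), fun h h0 hh S hS => ?_⟩
  have hh1 : h ≤ 1 := (hh.trans_le (min_le_left _ _)).le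
  have hKr : K * h < r / 2 := by
    have h2 := hh.trans_le (min_le_right _ _)
    rw [lt_div_iff₀ (by positivity)] at h2
    nlinarith
  have hball : ∀ z ∈ S, gridPt h z ∈ Metric.ball p r ∧ |F (gridPt h z)| ≤ L * (K * h) := by
    intro z hz
    obtain ⟨q, hq, hFq, hzq⟩ := hS z hz
    have hz' : gridPt h z ∈ Metric.ball p r := by
      rw [Metric.mem_ball] at hq ⊢
      have := dist_triangle (gridPt h z) q p
      rw [← dist_eq_norm] at hzq
      linarith
    refine ⟨hz', ?_⟩
    have h1 := hb q (Metric.ball_subset_ball (by linarith) hq) _ hz'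
    rw [hFq, sub_zero, Real.norm_eq_abs] at h1
    have h2 := F'.le_opNorm (gridPt h z - q)
    rw [Real.norm_eq_abs] at h2
    have h3 : |F (gridPt h z)| ≤ L * ‖gridPt h z - q‖ := by
      rw [hL, add_mul]
      have := abs_sub_abs_le_abs_sub (F (gridPt h z)) (F' (gridPt h z - q))
      linarith
    exact h3.trans (by gcongr)
  let φ : (Fin d → ℤ) → ({j // j ≠ i} → ℤ) := fun z j => z j
  have hfib : ∀ b ∈ S.image φ, (S.filter fun z => φ z = b).card ≤ 2 * ⌊A⌋₊ + 1 := by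
    intro b hb'
    obtain ⟨z₀, hz₀, rfl⟩ := Finset.mem_image.1 hb'
    have hz₀' := hball z₀ hz₀
    have hoff : ∀ z, φ z = φ z₀ → z = z₀ + Pi.single i (z i - z₀ i) := by
      intro z hz
      ext j
      by_cases hj : j = i
      · subst hj; simp
      · simpa [hj] using congrFun hz ⟨j, hj⟩
    calc (S.filter fun z => φ z = φ z₀).card
        ≤ (Finset.Icc (z₀ i - ⌊A⌋₊) (z₀ i + ⌊A⌋₊)).card := by
          refine Finset.card_le_card_of_injOn (fun z => z i) ?_ ?_
          · intro z hz
            rw [Finset.mem_coe, Finset.mem_filter] at hz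
            obtain ⟨hzS, hz⟩ := hz
            have hz' := hball z hzS
            have h1 := hb _ hz₀'.1 _ hz'.1
            have e : gridPt h z - gridPt h z₀ = (h * ((z i - z₀ i : ℤ) : ℝ)) • Pi.single i 1 := by
              conv_lhs => rw [hoff z hz, gridPt_add_single, add_sub_cancel_left]
              ext j
              by_cases hj : j = i
              · subst hj; simp
              · simp [hj]
            rw [e, map_smul, norm_smul, Pi.norm_single, norm_one, mul_one, smul_eq_mul,
              Real.norm_eq_abs, Real.norm_eq_abs, abs_mul h, abs_of_pos h0] at h1
            have h2 := abs_sub_abs_le_abs_sub (h * ((z i - z₀ i : ℤ) : ℝ) * F' (Pi.single i 1))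
              (F (gridPt h z) - F (gridPt h z₀))
            rw [abs_sub_comm (h * ((z i - z₀ i : ℤ) : ℝ) * F' (Pi.single i 1))] at h2
            rw [abs_mul, ← hm, abs_mul h, abs_of_pos h0] at h2
            have h3 := abs_sub (F (gridPt h z)) (F (gridPt h z₀))
            have h4 : |((z i - z₀ i : ℤ) : ℝ)| ≤ A := by
              rw [hA, le_div_iff₀ hm0]
              refine le_of_mul_le_mul_left ?_ h0
              linarith [hz'.2, hz₀'.2]
            have h5 : |z i - z₀ i| ≤ ⌊A⌋₊ := by
              rw [Int.abs_eq_natAbs]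
              exact_mod_cast Nat.le_floor (by rwa [Nat.cast_natAbs, Int.cast_abs])
            rw [Finset.mem_coe, Finset.mem_Icc]
            obtain ⟨h6, h7⟩ := abs_le.1 h5
            constructor <;> linarith
          · intro z hz z' hz' hzz
            rw [Finset.mem_coe, Finset.mem_filter] at hz hz'
            rw [hoff z hz.2, hoff z' hz'.2]
            simp only at hzz
            rw [hzz]
      _ = 2 * ⌊A⌋₊ + 1 := by
          rw [Int.card_Icc]
          omega
  have hmul := Finset.card_le_mul_card_image S _ hfib
  have himg : ((S.image φ).card : ℝ) ≤ ((2 * r + 1) / h) ^ (d - 1) := by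
    have := card_le_of_abs_sub_le (S.image φ) (c := fun j => p j) hr.le h0 hh1 ?_
    · simpa [Fintype.card_subtype_compl] using this
    · intro z hz j
      obtain ⟨z, hzS, rfl⟩ := Finset.mem_image.1 hz
      have h1 := (hball z hzS).1
      rw [Metric.mem_ball, dist_eq_norm] at h1
      exact (norm_le_pi_norm (gridPt h z - p) j).trans h1.le
  have hd : d = (d - 1) + 1 := by have := i.pos; omega
  calc S.card * h ^ d
      ≤ ((2 * ⌊A⌋₊ + 1 : ℕ) * ((2 * r + 1) / h) ^ (d - 1)) * h ^ d := by
        gcongr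
        refine le_trans (b := (2 * ⌊A⌋₊ + 1 : ℕ) * ((S.image φ).card : ℝ)) ?_ ?_
        · exact_mod_cast hmul
        · gcongr
    _ = (2 * ⌊A⌋₊ + 1 : ℕ) * (((2 * r + 1) / h) ^ (d - 1) * h ^ (d - 1)) * h := by
        conv_lhs => rw [hd, pow_succ]
        simp only [Nat.add_sub_cancel]
        ring
    _ = _ := by rw [← mul_pow, div_mul_cancel₀ _ h0.ne']

lemma card_near_frontier_le (K : ℕ) {D : Set (Fin d → ℝ)} (hDc : IsCompact (closure D))
    {F : (Fin d → ℝ) → ℝ} (hF : ContDiff ℝ 2 F)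
    (hfr : frontier D = {x | F x = 0}) (hgrad : ∀ x ∈ frontier D, fderiv ℝ F x ≠ 0) :
    ∃ δ > 0, ∃ C : ℝ, 0 ≤ C ∧ ∀ h : ℝ, 0 < h → h < δ → ∀ S : Finset (Fin d → ℤ),
      (∀ z ∈ S, ∃ q ∈ frontier D, ‖gridPt h z - q‖ ≤ K * h) → S.card * h ^ d ≤ C * h := by
  classical
  have hfc : IsCompact (frontier D) := hDc.of_isClosed_subset isClosed_frontier
    frontier_subset_closure
  have key : ∃ δ > 0, ∃ C : ℝ, 0 ≤ C ∧ ∀ h : ℝ, 0 < h → h < δ → ∀ S : Finset (Fin d → ℤ),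
      (∀ z ∈ S, ∃ q ∈ frontier D, F q = 0 ∧ ‖gridPt h z - q‖ ≤ K * h) →
      S.card * h ^ d ≤ C * h := by
    refine hfc.induction_on (p := fun s => ∃ δ > 0, ∃ C : ℝ, 0 ≤ C ∧ ∀ h : ℝ, 0 < h → h < δ →
      ∀ S : Finset (Fin d → ℤ), (∀ z ∈ S, ∃ q ∈ s, F q = 0 ∧ ‖gridPt h z - q‖ ≤ K * h) →
      S.card * h ^ d ≤ C * h) ?_ ?_ ?_ ?_
    · refine ⟨1, one_pos, 0, le_rfl, fun h _ _ S hS => ?_⟩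
      have : S = ∅ := Finset.eq_empty_of_forall_notMem fun z hz => by
        obtain ⟨q, hq, _⟩ := hS z hz
        exact hq
      simp [this]
    · rintro s t hst ⟨δ, hδ, C, hC, H⟩
      refine ⟨δ, hδ, C, hC, fun h h0 hh S hS => H h h0 hh S fun z hz => ?_⟩
      obtain ⟨q, hq, hq'⟩ := hS z hz
      exact ⟨q, hst hq, hq'⟩
    · rintro s t ⟨δ, hδ, C, hC, H⟩ ⟨δ', hδ', C', hC', H'⟩
      refine ⟨min δ δ', lt_min hδ hδ', C + C', add_nonneg hC hC', fun h h0 hh S hS => ?_⟩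
      set P : (Fin d → ℤ) → Prop := fun z => ∃ q ∈ s, F q = 0 ∧ ‖gridPt h z - q‖ ≤ K * h
      have h1 := H h h0 (hh.trans_le (min_le_left _ _)) (S.filter P)
        fun z hz => (Finset.mem_filter.1 hz).2
      have h2 := H' h h0 (hh.trans_le (min_le_right _ _)) (S.filter fun z => ¬ P z) fun z hz => by
        obtain ⟨hzS, hzP⟩ := Finset.mem_filter.1 hz
        obtain ⟨q, hq | hq, hq'⟩ := hS z hzS
        · exact absurd ⟨q, hq, hq'⟩ hzP
        · exact ⟨q, hq, hq'⟩
      have h3 : ((S.filter P).card : ℝ) + (S.filter fun z => ¬ P z).card = S.card := by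
        exact_mod_cast Finset.card_filter_add_card_filter_not (s := S) P
      rw [← h3, add_mul, add_mul]
      exact add_le_add h1 h2
    · intro p hp
      obtain ⟨ρ, hρ, δ, hδ, C, H⟩ := card_near_frontier_le_local K
        (hF.contDiffAt.hasStrictFDerivAt two_ne_zero : HasStrictFDerivAt F (fderiv ℝ F p) p)
        (hgrad p hp)
      refine ⟨_, mem_nhdsWithin_of_mem_nhds (Metric.ball_mem_nhds p hρ), δ, hδ, max C 0,
        le_max_right _ _, fun h h0 hh S hS => (H h h0 hh S hS).trans ?_⟩
      gcongr
      exact le_max_left _ _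
  obtain ⟨δ, hδ, C, hC, H⟩ := key
  refine ⟨δ, hδ, C, hC, fun h h0 hh S hS => H h h0 hh S fun z hz => ?_⟩
  obtain ⟨q, hq, hzq⟩ := hS z hz
  exact ⟨q, hq, by rw [hfr] at hq; exact hq, hzq⟩

end Counting

section Consistency

variable {d K : ℕ}

lemma norm_gridPt_sub_le {h : ℝ} (h0 : 0 ≤ h) {w z : Fin d → ℤ}
    (hw : (∑ i, |w i - z i|) ≤ (K : ℤ)) : ‖gridPt h w - gridPt h z‖ ≤ K * h := by
  refine (pi_norm_le_iff_of_nonneg (by positivity)).2 fun i => ?_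
  have h1 : |w i - z i| ≤ (K : ℤ) :=
    (Finset.single_le_sum (f := fun i => |w i - z i|) (fun _ _ => abs_nonneg _)
      (Finset.mem_univ i)).trans hw
  have h2 : |(w i : ℝ) - z i| ≤ K := by exact_mod_cast h1
  rw [Pi.sub_apply, gridPt, gridPt, ← mul_sub, norm_mul, Real.norm_of_nonneg h0, mul_comm]
  exact mul_le_mul_of_nonneg_right h2 h0

lemma exists_abs_taylor_two_le {D : Set (Fin d → ℝ)} (hDo : IsOpen D)
    (hDc : IsCompact (closure D)) {F : (Fin d → ℝ) → ℝ} (hF : ContDiff ℝ 2 F)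
    (hDF : D = {x | F x < 0}) (hgrad : ∀ x ∈ frontier D, fderiv ℝ F x ≠ 0) :
    ∃ δ > 0, ∃ C, 0 ≤ C ∧ ∀ u : (Fin d → ℝ) → ℝ, ContDiffOn ℝ 3 u (closure D) →
      ∀ x ∈ D, ∀ y ∈ closure D, ‖y - x‖ < δ →
      |u y - (u x + fderiv ℝ u x (y - x) + (1 / 2) * fderiv ℝ (fderiv ℝ u) x (y - x) (y - x))|
        ≤ Mk d D u 3 * (3 * (C * ‖y - x‖)) ^ 3 := by
  obtain ⟨δ, hδ, C, hC, H⟩ := exists_chainJoined_of_isCompact hDo hDc hF hDF hgrad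
  refine ⟨δ, hδ, C, hC, fun u hu x hx y hy hyx => ?_⟩
  have hyc : y ∈ closure (Metric.ball x δ ∩ D) :=
    Metric.isOpen_ball.inter_closure ⟨by rwa [Metric.mem_ball, dist_eq_norm], hy⟩
  have huc : ContinuousWithinAt u (Metric.ball x δ ∩ D) y :=
    (hu.continuousOn y hy).mono (Set.inter_subset_right.trans subset_closure)
  refine ContinuousWithinAt.closure_le hyc
    (f := fun y => |u y - (u x + fderiv ℝ u x (y - x) +
      (1 / 2) * fderiv ℝ (fderiv ℝ u) x (y - x) (y - x))|)
    (g := fun y => Mk d D u 3 * (3 * (C * ‖y - x‖)) ^ 3)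
    (huc.sub (Continuous.continuousWithinAt (by fun_prop))).abs
    (Continuous.continuousWithinAt (by fun_prop)) fun q hq => ?_
  refine abs_taylor_two_le hDo (hu.mono subset_closure)
    (fun x hx => norm_iteratedFDeriv_le_Mk hDo hDc (n := 3) hu le_rfl le_rfl hx)
    (H x hx q hq.2 ?_)
  have := hq.1
  rwa [Metric.mem_ball, dist_eq_norm] at this

lemma exists_abs_scaledLh_add_contLap_le (hK : 1 ≤ K) {κ : ℕ → ℝ} (hκ1 : κ 1 = 1)
    (hκ : ∀ i ∈ Finset.Icc 1 K, 0 ≤ κ i) {D : Set (Fin d → ℝ)} (hDo : IsOpen D)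
    (hDc : IsCompact (closure D)) {F : (Fin d → ℝ) → ℝ} (hF : ContDiff ℝ 2 F)
    (hDF : D = {x | F x < 0}) (hgrad : ∀ x ∈ frontier D, fderiv ℝ F x ≠ 0) :
    ∃ δ > 0, ∃ C, 0 ≤ C ∧ ∀ u : (Fin d → ℝ) → ℝ, ContDiffOn ℝ 3 u (closure D) →
      ∀ h : ℝ, 0 < h → h < δ → ∀ z ∈ Rh d D K h, gridPt h z ∈ D →
      ∀ v : (Fin d → ℤ) → ℝ, (∀ w ∈ Dh d D h, v w = u (gridPt h w)) →
      |scaledLh d K κ v z + h ^ 2 * contLap d u (gridPt h z)| ≤ C * Mk d D u 3 * h ^ 3 := by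
  obtain ⟨δ, hδ, C, hC, H⟩ := exists_abs_taylor_two_le hDo hDc hF hDF hgrad
  refine ⟨δ / (K + 1), by positivity, scaledLhBound d K κ * (3 * (C * K)) ^ 3,
    mul_nonneg (scaledLhBound_nonneg hκ) (by positivity), fun u hu h h0 hh z hz hzD v hv => ?_⟩
  have hKδ : K * h < δ := by
    rw [lt_div_iff₀ (by positivity)] at hh
    nlinarith
  set Q : (Fin d → ℤ) → ℝ := fun w => u (gridPt h z) +
    fderiv ℝ u (gridPt h z) (gridPt h w - gridPt h z) +
    (1 / 2) * fderiv ℝ (fderiv ℝ u) (gridPt h z) (gridPt h w - gridPt h z)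
      (gridPt h w - gridPt h z) with hQ
  have hQz : scaledLh d K κ Q z = -(h ^ 2 * contLap d u (gridPt h z)) := by
    rw [hQ, contLap_eq]
    exact scaledLh_quadratic hK hκ1 h _ z _ _
  have e : scaledLh d K κ v z + h ^ 2 * contLap d u (gridPt h z) = scaledLh d K κ (v - Q) z := by
    rw [map_sub, Pi.sub_apply, hQz, sub_neg_eq_add]
  rw [e]
  refine (abs_scaledLh_le hκ (ε := Mk d D u 3 * (3 * (C * (K * h))) ^ 3) fun w hw => ?_).trans
    (le_of_eq (by ring))
  have hwD := hz.2 w hw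
  have hn := norm_gridPt_sub_le h0.le hw
  rw [Pi.sub_apply, hv w hwD]
  refine (H u hu _ hzD _ hwD (hn.trans_lt hKδ)).trans ?_
  have := Mk_nonneg d D u 3
  gcongr
  exact hn

end Consistency

section Assembly

variable {d K : ℕ}

lemma Dh_finite {D : Set (Fin d → ℝ)} {R : ℝ} (hR : ∀ x ∈ closure D, ‖x‖ ≤ R) {h : ℝ}
    (h0 : 0 < h) : (Dh d D h).Finite := by
  refine (Set.finite_Icc (fun _ : Fin d => -⌈R / h⌉) (fun _ => ⌈R / h⌉)).subset fun z hz => ?_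
  have hb : ∀ i, |(z i : ℝ)| ≤ R / h := fun i => by
    have h1 : |h * (z i : ℝ)| ≤ R := (norm_le_pi_norm (gridPt h z) i).trans (hR _ hz)
    rwa [abs_mul, abs_of_pos h0, mul_comm, ← le_div_iff₀ h0] at h1
  refine ⟨fun i => ?_, fun i => ?_⟩
  · have h1 := (abs_le.1 (hb i)).1
    have h2 := Int.le_ceil (R / h)
    have : (-⌈R / h⌉ : ℝ) ≤ z i := by linarith
    exact_mod_cast this
  · exact_mod_cast (abs_le.1 (hb i)).2.trans (Int.le_ceil _)

lemma Rh_subset_Dh (D : Set (Fin d → ℝ)) (h : ℝ) : Rh d D K h ⊆ Dh d D h := fun _ hz => hz.1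

lemma tsum_Dh_eq_gridPair {D : Set (Fin d → ℝ)} {h : ℝ} (hfin : (Dh d D h).Finite)
    (φ : (Fin d → ℤ) → ℝ) :
    ∑' z : ↥(Dh d D h), ((Rh d D K h).indicator φ (z : Fin d → ℤ)) ^ 2 =
      gridPair ((Rh d D K h).indicator φ) ((Rh d D K h).indicator φ) := by
  rw [gridPair_self, tsum_subtype (Dh d D h) (fun z => ((Rh d D K h).indicator φ z) ^ 2)]
  have e : (Dh d D h).indicator (fun z => ((Rh d D K h).indicator φ z) ^ 2) =
      fun z => ((Rh d D K h).indicator φ z) ^ 2 := by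
    rw [Set.indicator_eq_self]
    intro z hz
    by_contra hzD
    exact hz (by simp [Set.indicator_of_notMem fun h => hzD (Rh_subset_Dh D _ h)])
  rw [e, tsum_eq_finsum]
  refine hfin.subset ?_
  rw [← e]
  exact Set.support_indicator_subset

/-- For `z ∈ B_h`, the point `hz` is close to the boundary and `u` is small there. -/
lemma Bh_near_frontier {D : Set (Fin d → ℝ)} (hDo : IsOpen D) (hDc : IsCompact (closure D))
    {u : (Fin d → ℝ) → ℝ} (hu : ContDiffOn ℝ 3 u (closure D)) (hu0 : ∀ x ∈ frontier D, u x = 0)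
    {h : ℝ} (h0 : 0 < h) {z : Fin d → ℤ} (hz : z ∈ Bh d D K h) :
    (∃ q ∈ frontier D, ‖gridPt h z - q‖ ≤ K * h) ∧
      |u (gridPt h z)| ≤ Mk d D u 1 * (K * h) := by
  obtain ⟨hzD, hzR⟩ := hz
  obtain ⟨w, hw, hwD⟩ : ∃ w : Fin d → ℤ, (∑ i, |w i - z i|) ≤ (K : ℤ) ∧ w ∉ Dh d D h := by
    by_contra! hcon
    exact hzR ⟨hzD, hcon⟩
  have hn := norm_gridPt_sub_le h0.le hw
  have hM := Mk_nonneg d D u 1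
  obtain ⟨⟨q, hq, hzq⟩, hub⟩ := exists_frontier_norm_le hDo hu.continuousOn
    (fun x hx => ((hu.mono subset_closure).contDiffAt (hDo.mem_nhds hx)).differentiableAt
      three_ne_zero) hu0 hM
    (fun x hx => by
      have := norm_iteratedFDeriv_le_Mk hDo hDc (n := 3) (j := 1) hu (by norm_num) le_rfl hx
      rwa [norm_iteratedFDeriv_one] at this)
    (x := gridPt h z) (y := gridPt h w) hzD hwD
  exact ⟨⟨q, hq, hzq.trans hn⟩, hub.trans (by gcongr)⟩

end Assembly

end ErrorEstimate

theorem stmt8 (d K : ℕ) (hd : 1 ≤ d) (hK : 1 ≤ K) (κ : ℕ → ℝ)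
    (hκ1 : κ 1 = 1) (hκnn : ∀ i, 2 ≤ i → i ≤ K → 0 ≤ κ i) (hκK : 0 < κ K)
    (D : Set (Fin d → ℝ)) (hDo : IsOpen D) (hDconn : IsConnected D)
    (hDb : Bornology.IsBounded D)
    -- `D` has `C²` boundary, encoded by a `C²` defining function with non-vanishing
    -- gradient on the boundary:
    (F : (Fin d → ℝ) → ℝ) (hF : ContDiff ℝ 2 F) (hDF : D = {x | F x < 0})
    (hfr : frontier D = {x | F x = 0}) (hgrad : ∀ x ∈ frontier D, fderiv ℝ F x ≠ 0) :
    ∃ C : ℝ, 0 < C ∧ ∃ h₀ : ℝ, 0 < h₀ ∧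
      ∀ u f : (Fin d → ℝ) → ℝ, ContDiffOn ℝ 3 u (closure D) →
        (∀ x ∈ D, -contLap d u x = f x) → (∀ x ∈ frontier D, u x = 0) →
        ∀ h : ℝ, 0 < h → h < h₀ →
          ∀ uh : (Fin d → ℤ) → ℝ,
            (∀ z ∈ Rh d D K h, Lh d K κ h uh z = f (fun i => h * (z i : ℝ))) →
            (∀ z ∈ Bh d D K h, uh z = 0) →
            h ^ d * ∑' z : ↥(Dh d D h),
                ((Rh d D K h).indicator
                  (fun w => u (fun i => h * (w i : ℝ)) - uh w) (z : Fin d → ℤ)) ^ 2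
              ≤ C * (Mk d D u 3 ^ 2 * h ^ 2 + h * (Mk d D u 3 ^ 2 * h ^ 4 + Mk d D u 1 ^ 2)) := by
  have hκ : ∀ i ∈ Finset.Icc 1 K, 0 ≤ κ i := by
    intro i hi
    obtain ⟨h1, h2⟩ := Finset.mem_Icc.1 hi
    rcases h1.eq_or_lt with rfl | h1
    · rw [hκ1]; exact zero_le_one
    · exact hκnn i h1 h2
  have hDc : IsCompact (closure D) := hDb.isCompact_closure
  obtain ⟨R, hR0, hR⟩ : ∃ R > 0, ∀ x ∈ closure D, ‖x‖ ≤ R :=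
    hDc.isBounded.exists_pos_norm_le
  obtain ⟨δ₁, hδ₁, H₁⟩ := exists_forall_Rh_mem (K := K) hK hDo hDc hF hDF hfr hgrad
  obtain ⟨δ₂, hδ₂, C₂, hC₂, H₂⟩ := card_near_frontier_le K hDc hF hfr hgrad
  obtain ⟨δ₃, hδ₃, C₃, hC₃, H₃⟩ :=
    exists_abs_scaledLh_add_contLap_le hK hκ1 hκ hDo hDc hF hDF hgrad
  set β := scaledLhBound d K κ
  have hβ0 : 0 ≤ β := scaledLhBound_nonneg hκ
  set A₁ := 64 * (R + 1) ^ 4 * C₃ ^ 2 * (2 * R + 1) ^ d with hA₁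
  set A₂ := 8 * β * (R + 1) ^ 2 * C₂ * K ^ 2 with hA₂
  have hA₁0 : 0 ≤ A₁ := by positivity
  have hA₂0 : 0 ≤ A₂ := by positivity
  refine ⟨A₁ + A₂ + 1, by positivity, min 1 (min δ₁ (min δ₂ δ₃)),
    lt_min one_pos (lt_min hδ₁ (lt_min hδ₂ hδ₃)), ?_⟩
  intro u f hu hf hu0 h h0 hh uh huh hBuh
  rw [lt_min_iff, lt_min_iff, lt_min_iff] at hh
  obtain ⟨hh1, hhδ₁, hhδ₂, hhδ₃⟩ := hh
  have hfin : (Dh d D h).Finite := Dh_finite hR h0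
  have hBfin : (Bh d D K h).Finite := hfin.subset Set.sdiff_subset
  set w : (Fin d → ℤ) → ℝ := (Rh d D K h).indicator (fun w => u (fun i => h * (w i : ℝ)) - uh w)
    with hw
  set g : (Fin d → ℤ) → ℝ := (Bh d D K h).indicator (fun w => u (gridPt h w)) with hg
  set M₁ := Mk d D u 1
  set M₃ := Mk d D u 3
  have hwR : ∀ z, w z ≠ 0 → z ∈ Rh d D K h := fun z hz => by
    by_contra hzR
    exact hz (Set.indicator_of_notMem hzR _)
  have hsum : ∀ z ∈ Dh d D h, (w + g + uh) z = u (gridPt h z) := by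
    intro z hz
    rw [Pi.add_apply, Pi.add_apply]
    by_cases hzR : z ∈ Rh d D K h
    · rw [hw, hg, Set.indicator_of_mem hzR, Set.indicator_of_notMem fun hB => hB.2 hzR]
      simp only [add_zero, sub_add_cancel]
      rfl
    · rw [hw, hg, Set.indicator_of_notMem hzR,
        Set.indicator_of_mem (show z ∈ Bh d D K h from ⟨hz, hzR⟩), hBuh z ⟨hz, hzR⟩]
      simp
  have hτ : ∀ z, w z ≠ 0 → |scaledLh d K κ (w + g) z| ≤ C₃ * M₃ * h ^ 3 := by
    intro z hz
    have hzR := hwR z hz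
    have hzD := H₁ h h0 hhδ₁ z hzR
    have h1 := H₃ u hu h h0 hhδ₃ z hzR hzD _ hsum
    have h2 : scaledLh d K κ uh z = -(h ^ 2 * contLap d u (gridPt h z)) := by
      rw [← sq_mul_Lh κ h0.ne', huh z hzR, ← mul_neg]
      congr 1
      exact (hf _ hzD).symm
    rw [map_add, Pi.add_apply, h2, neg_add_cancel_right] at h1
    exact h1
  have hN : ∀ z, w z ≠ 0 → |(z ⟨0, hd⟩ : ℝ)| ≤ R / h := by
    intro z hz
    have h1 : |h * (z ⟨0, hd⟩ : ℝ)| ≤ R :=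
      (norm_le_pi_norm (gridPt h z) ⟨0, hd⟩).trans (hR _ (hwR z hz).1)
    rwa [abs_mul, abs_of_pos h0, mul_comm, ← le_div_iff₀ h0] at h1
  have hgfin : Function.HasFiniteSupport g := hBfin.subset Set.support_indicator_subset
  have main := gridPair_self_le_of_scaledLh hK hκ1 hκ hgfin hfin.toFinset
    (fun z hz => hfin.mem_toFinset.2 (hwR z hz).1) ⟨0, hd⟩ (div_nonneg hR0.le h0.le) hN hτ
  have hgg : gridPair g g ≤ hBfin.toFinset.card * (M₁ * (K * h)) ^ 2 := by
    rw [gridPair_self, finsum_eq_sum_of_support_subset (s := hBfin.toFinset), ← nsmul_eq_mul]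
    · refine Finset.sum_le_card_nsmul _ _ _ fun z hz => ?_
      have hzB := hBfin.mem_toFinset.1 hz
      rw [hg, Set.indicator_of_mem hzB, ← sq_abs]
      have := (Bh_near_frontier hDo hDc hu hu0 h0 hzB).2
      gcongr
    · intro z hz
      rw [hBfin.coe_toFinset]
      by_contra hzB
      exact hz (by simp [hg, Set.indicator_of_notMem hzB])
  have hcardB : hBfin.toFinset.card * h ^ d ≤ C₂ * h := H₂ h h0 hhδ₂ _ fun z hz =>
    (Bh_near_frontier hDo hDc hu hu0 h0 (hBfin.mem_toFinset.1 hz)).1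
  have hcardD : hfin.toFinset.card * h ^ d ≤ (2 * R + 1) ^ d := by
    have h1 := card_le_of_abs_sub_le hfin.toFinset (c := 0) hR0.le h0 hh1.le fun z hz j => by
      rw [Pi.zero_apply, sub_zero]
      exact (norm_le_pi_norm (gridPt h z) j).trans (hR _ (hfin.mem_toFinset.1 hz))
    rw [Fintype.card_fin, div_pow, le_div_iff₀ (by positivity)] at h1
    exact h1
  have hN1 : R / h + 1 ≤ (R + 1) / h := by
    rw [add_div]
    have : 1 ≤ 1 / h := by rw [le_div_iff₀ h0]; linarith
    linarith
  rw [tsum_Dh_eq_gridPair hfin]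
  calc h ^ d * gridPair w w
      ≤ h ^ d * (64 * (R / h + 1) ^ 4 * (hfin.toFinset.card * (C₃ * M₃ * h ^ 3) ^ 2)
          + 8 * β * (R / h + 1) ^ 2 * (hBfin.toFinset.card * (M₁ * (K * h)) ^ 2)) := by
        refine mul_le_mul_of_nonneg_left (main.trans ?_) (by positivity)
        gcongr
    _ = 64 * (R / h + 1) ^ 4 * ((hfin.toFinset.card * h ^ d) * (C₃ * M₃ * h ^ 3) ^ 2)
          + 8 * β * (R / h + 1) ^ 2 * ((hBfin.toFinset.card * h ^ d) * (M₁ * (K * h)) ^ 2) := by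
        ring
    _ ≤ 64 * ((R + 1) / h) ^ 4 * ((2 * R + 1) ^ d * (C₃ * M₃ * h ^ 3) ^ 2)
          + 8 * β * ((R + 1) / h) ^ 2 * (C₂ * h * (M₁ * (K * h)) ^ 2) := by
        gcongr
    _ = A₁ * (M₃ ^ 2 * h ^ 2) + A₂ * (h * M₁ ^ 2) := by
        rw [hA₁, hA₂]
        field_simp
    _ ≤ (A₁ + A₂ + 1) * (M₃ ^ 2 * h ^ 2 + h * (M₃ ^ 2 * h ^ 4 + M₁ ^ 2)) := by
        have p1 : 0 ≤ M₃ ^ 2 * h ^ 2 := by positivity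
        have p2 : 0 ≤ h * M₁ ^ 2 := by positivity
        have p3 : 0 ≤ h * (M₃ ^ 2 * h ^ 4) := by positivity
        nlinarith [mul_nonneg hA₁0 p2, mul_nonneg hA₂0 p1, mul_nonneg hA₁0 p3,
          mul_nonneg hA₂0 p3]
end
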